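/- Let r ≥ 3 and let F be a quasi-linear, head-tail-mixing r-graph which admits the descriptive sequence XX…XZZYY…Y (consisting of r−2 letters X, then two letters Z, then r−2 letters Y). For every ε > 0, every locally (1/4+ε)-dense sequence of r-graphs has a member containing F as a subgraph. -/

import Mathlib

namespace UTD

/-- An `r`-uniform hypergraph on a finite vertex set of naturals. -/
structure RGraph (r : ℕ) where
  verts : Finset ℕ
  edges : Finset (Finset ℕ)
  edges_subset : ∀ e ∈ edges, e ⊆ verts
  edges_card : ∀ e ∈ edges, e.card = r

/-- `F` is a subgraph of `H`: an injection of `V(F)` into `V(H)` mapping edges to edges. -/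
def IsSubgraph {r : ℕ} (F H : RGraph r) : Prop :=
  ∃ φ : ℕ → ℕ, Set.InjOn φ ↑F.verts ∧ (∀ v ∈ F.verts, φ v ∈ H.verts) ∧
    ∀ e ∈ F.edges, e.image φ ∈ H.edges

/-- `H` is `(d, ε)`-dense: every `S ⊆ V(H)` with `|S| ≥ ε|V(H)|` spans at least
`(d - ε) * C(|S|, r)` edges. -/
def IsDense {r : ℕ} (H : RGraph r) (d ε : ℝ) : Prop :=
  ∀ S ⊆ H.verts, ε * H.verts.card ≤ S.card →
    (d - ε) * (S.card.choose r : ℝ) ≤ ((H.edges.filter (fun e => e ⊆ S)).card : ℝ)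

/-- A sequence of `r`-graphs is locally `d`-dense. -/
def LocallyDense {r : ℕ} (H : ℕ → RGraph r) (d : ℝ) : Prop :=
  ∃ ε : ℕ → ℝ, (∀ n, 0 < ε n) ∧
    Filter.Tendsto ε Filter.atTop (nhds 0) ∧
    Filter.Tendsto (fun n => (H n).verts.card) Filter.atTop Filter.atTop ∧
    ∀ n, IsDense (H n) d (ε n)

/-- The role (set of ranks, 1-indexed) that the elements of `p` play within the
set `e`, with respect to the order given by `ord`. -/
def role (ord : ℕ → ℕ) (e p : Finset ℕ) : Finset ℕ :=
  p.image (fun v => (e.filter (fun w => ord w < ord v)).card + 1)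

/-- Twin pair of edges: distinct edges intersecting in exactly two vertices. -/
def IsTwin {r : ℕ} (F : RGraph r) (e f : Finset ℕ) : Prop :=
  e ∈ F.edges ∧ f ∈ F.edges ∧ e ≠ f ∧ (e ∩ f).card = 2

/-- Quasi-linear: every edge `e` has a unique twin, and all other edges meet `e`
in at most one vertex. -/
def QuasiLinear {r : ℕ} (F : RGraph r) : Prop :=
  ∀ e ∈ F.edges, ∃ f ∈ F.edges, f ≠ e ∧ (e ∩ f).card = 2 ∧
    ∀ f' ∈ F.edges, f' ≠ e → f' ≠ f → (e ∩ f').card ≤ 1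

/-- `F` with the vertex order `ord` is consistently ordered. -/
def ConsistentlyOrdered {r : ℕ} (F : RGraph r) (ord : ℕ → ℕ) : Prop :=
  ∀ e f, IsTwin F e f → role ord e (e ∩ f) = role ord f (e ∩ f)

/-- `F` is consistent: some linear order of its vertices makes it consistently ordered. -/
def Consistent {r : ℕ} (F : RGraph r) : Prop :=
  ∃ ord : ℕ → ℕ, Set.InjOn ord ↑F.verts ∧ ConsistentlyOrdered F ord

/-- `p` is the head of the edge `e`: its two smallest vertices w.r.t. `ord`. -/
def IsHead (ord : ℕ → ℕ) (e p : Finset ℕ) : Prop :=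
  p ⊆ e ∧ p.card = 2 ∧ ∀ u ∈ p, ∀ w ∈ e, w ∉ p → ord u < ord w

/-- `p` is the tail of the edge `e`: its two largest vertices w.r.t. `ord`. -/
def IsTail (ord : ℕ → ℕ) (e p : Finset ℕ) : Prop :=
  p ⊆ e ∧ p.card = 2 ∧ ∀ u ∈ p, ∀ w ∈ e, w ∉ p → ord w < ord u

/-- Head-tail-mixing: for every linear order of the vertex set there are edges
`e, f` such that the head of `e` equals the tail of `f`. -/
def HeadTailMixing {r : ℕ} (F : RGraph r) : Prop :=
  ∀ ord : ℕ → ℕ, Set.InjOn ord ↑F.verts →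
    ∃ e ∈ F.edges, ∃ f ∈ F.edges, ∃ p : Finset ℕ, IsHead ord e p ∧ IsTail ord f p

inductive Letter : Type
  | X | Y | Z
  deriving DecidableEq

/-- A descriptive sequence of order `r`: `2r - 2` letters, among which `r - 2`
are `X`, `r - 2` are `Y`, and two are `Z`. -/
def IsDescSeq (r : ℕ) (σ : Fin (2 * r - 2) → Letter) : Prop :=
  (Finset.univ.filter (fun i => σ i = Letter.X)).card = r - 2 ∧
  (Finset.univ.filter (fun i => σ i = Letter.Y)).card = r - 2 ∧
  (Finset.univ.filter (fun i => σ i = Letter.Z)).card = 2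

/-- The descriptive sequence `XX…XZZYY…Y`. -/
def headTailSeq (r : ℕ) : Fin (2 * r - 2) → Letter := fun i =>
  if (i : ℕ) < r - 2 then Letter.X
  else if (i : ℕ) < r then Letter.Z
  else Letter.Y

/-- The role (set of ranks, 1-indexed) played by the positions of the two `Z`s
within the positions carrying letters different from `avoid`. -/
def seqRole (r : ℕ) (σ : Fin (2 * r - 2) → Letter) (avoid : Letter) : Finset ℕ :=
  (Finset.univ.filter (fun i => σ i = Letter.Z)).image
    (fun i => (Finset.univ.filter (fun j => σ j ≠ avoid ∧ j < i)).card + 1)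

/-- A descriptive sequence is consistent if its two `Z`s play the same role among
the `X/Z` positions as among the `Y/Z` positions. -/
def SeqConsistent (r : ℕ) (σ : Fin (2 * r - 2) → Letter) : Prop :=
  seqRole r σ Letter.Y = seqRole r σ Letter.X

def SeqInconsistent (r : ℕ) (σ : Fin (2 * r - 2) → Letter) : Prop :=
  IsDescSeq r σ ∧ ¬ SeqConsistent r σ

/-- The descriptive sequence `σ` describes the pair of edges `{e, f}` under the
vertex order `ord`. -/
def Describes (r : ℕ) (σ : Fin (2 * r - 2) → Letter) (ord : ℕ → ℕ)
    (e f : Finset ℕ) : Prop :=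
  ∃ w : Fin (2 * r - 2) → ℕ,
    (∀ i j : Fin (2 * r - 2), i < j → ord (w i) < ord (w j)) ∧
    (∀ v : ℕ, v ∈ e ∪ f ↔ ∃ i, w i = v) ∧
    (((∀ i, w i ∈ e ↔ σ i ≠ Letter.Y) ∧ (∀ i, w i ∈ f ↔ σ i ≠ Letter.X)) ∨
     ((∀ i, w i ∈ e ↔ σ i ≠ Letter.X) ∧ (∀ i, w i ∈ f ↔ σ i ≠ Letter.Y)))

/-- A quasi-linear `r`-graph admits the descriptive sequence `σ`: there is a
linear order of its vertices in which every twin pair of edges is described by `σ`. -/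
def AdmitsSeq {r : ℕ} (F : RGraph r) (σ : Fin (2 * r - 2) → Letter) : Prop :=
  ∃ ord : ℕ → ℕ, Set.InjOn ord ↑F.verts ∧
    ∀ e f, IsTwin F e f → Describes r σ ord e f

/-- Linear hypergraph: any two distinct edges intersect in at most one vertex. -/
def LinearGraph {r : ℕ} (H : RGraph r) : Prop :=
  ∀ e ∈ H.edges, ∀ f ∈ H.edges, e ≠ f → (e ∩ f).card ≤ 1

/-- Nowhere-empty sequence of `r`-graphs. -/
def NowhereEmpty {r : ℕ} (H : ℕ → RGraph r) : Prop :=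
  ∀ c : ℝ, 0 < c → ∃ n₀ : ℕ, ∀ n ≥ n₀, ∀ S : Fin r → Finset ℕ,
    (∀ i, S i ⊆ (H n).verts) →
    (∀ i j, i ≠ j → Disjoint (S i) (S j)) →
    (∀ i, c * (H n).verts.card ≤ (S i).card) →
    ∃ e ∈ (H n).edges, ∀ i, (e ∩ S i).Nonempty

/-- A `(k, r)`-reduced hypergraph. -/
structure ReducedGraph (k r : ℕ) where
  part : Fin k → Fin k → Finset ℕ
  part_symm : ∀ i j, part i j = part j i
  part_disj : ∀ i j i' j' : Fin k, i < j → i' < j' → (i, j) ≠ (i', j') →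
    Disjoint (part i j) (part i' j')
  edges : Finset (Finset ℕ)
  edges_card : ∀ e ∈ edges, e.card = r.choose 2
  edges_struct : ∀ e ∈ edges, ∃ t : Fin r → Fin k, StrictMono t ∧
    ∀ a b : Fin r, a < b → (e ∩ part (t a) (t b)).card = 1

/-- The constituent `A_{t 0, …, t (r-1)}` of a reduced hypergraph. -/
def constituent {k r : ℕ} (H : ReducedGraph k r) (t : Fin r → Fin k) :
    Finset (Finset ℕ) :=
  H.edges.filter (fun e => ∀ a b : Fin r, a < b → (e ∩ H.part (t a) (t b)).card = 1)

/-- A reduced hypergraph has density at least `d`. -/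
def HasDensity {k r : ℕ} (H : ReducedGraph k r) (d : ℝ) : Prop :=
  ∀ t : Fin r → Fin k, StrictMono t →
    d * ∏ p ∈ Finset.univ.filter (fun p : Fin r × Fin r => p.1 < p.2),
      ((H.part (t p.1) (t p.2)).card : ℝ) ≤ ((constituent H t).card : ℝ)

/-- The `(2r-2)`-tuple of indices `t` admits the descriptive sequence `σ` in the
reduced hypergraph `H`. -/
def TupleAdmits {k r : ℕ} (H : ReducedGraph k r) (σ : Fin (2 * r - 2) → Letter)
    (t : Fin (2 * r - 2) → Fin k) : Prop :=
  ∃ tx ty : Fin r → Fin k, StrictMono tx ∧ StrictMono ty ∧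
    Set.range tx = t '' {i | σ i ≠ Letter.Y} ∧
    Set.range ty = t '' {i | σ i ≠ Letter.X} ∧
    ∃ eX ∈ constituent H tx, ∃ eY ∈ constituent H ty, (eX ∩ eY).card = 1

/-- The uniform Turán density threshold `C(r,2)^(-C(r,2))`. -/
noncomputable def piR (r : ℕ) : ℝ := ((r.choose 2 : ℝ) ^ (r.choose 2))⁻¹


end UTD

namespace UTD

lemma ramsey_aux {C : Type} [Fintype C] [DecidableEq C] (r : ℕ) :
    ∀ m : ℕ, ∃ M : ℕ, ∀ (α : Type) [LinearOrder α] (S : Finset α), M ≤ S.card → ∀ col : Finset α → C,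
      ∃ K ⊆ S, K.card = m ∧ ∃ c, ∀ I ⊆ K, I.card = r → col I = c := by
  induction r with
  | zero =>
    intro m
    refine ⟨m, fun α _ S hS col => ?_⟩
    obtain ⟨K, hK, hc⟩ := Finset.exists_subset_card_eq hS
    refine ⟨K, hK, hc, col ∅, fun I _ hI => ?_⟩
    rw [Finset.card_eq_zero.mp hI]
  | succ r ih =>
    have key : ∀ n : ℕ, ∃ M : ℕ, ∀ (α : Type) [LinearOrder α] (S : Finset α), M ≤ S.card → ∀ col : Finset α → C,
        ∃ B ⊆ S, B.card = n ∧ ∃ χ : α → C, ∀ a ∈ B, ∀ I ⊆ B, I.card = r →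
          (∀ b ∈ I, a < b) → col (insert a I) = χ a := by
      intro n
      induction n with
      | zero =>
        refine ⟨0, fun α _ S _ col => ⟨∅, by simp, by simp, fun _ => col ∅, by simp⟩⟩
      | succ n ihn =>
        obtain ⟨M1, hM1⟩ := ihn
        obtain ⟨M2, hM2⟩ := ih M1
        refine ⟨M2 + 1, fun α _ S hS col => ?_⟩
        have hne : S.Nonempty := Finset.card_pos.mp (by omega)
        set a := S.min' hne with ha
        have haS : a ∈ S := Finset.min'_mem _ _
        obtain ⟨S', hS', hS'c, c, hc⟩ := hM2 α (S.erase a)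
          (by rw [Finset.card_erase_of_mem haS]; omega) (fun I => col (insert a I))
        obtain ⟨B, hB, hBc, χ, hχ⟩ := hM1 α S' hS'c.ge col
        have hlt : ∀ b ∈ B, a < b := by
          intro b hb
          have h1 := hS' (hB hb)
          rw [Finset.mem_erase] at h1
          exact lt_of_le_of_ne (Finset.min'_le _ _ h1.2) (Ne.symm h1.1)
        have haB : a ∉ B := fun h => lt_irrefl _ (hlt a h)
        refine ⟨insert a B, ?_, ?_, fun x => if x = a then c else χ x, ?_⟩
        · intro x hx
          rcases Finset.mem_insert.mp hx with rfl | hx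
          · exact haS
          · exact Finset.mem_of_mem_erase (hS' (hB hx))
        · rw [Finset.card_insert_of_notMem haB, hBc]
        · intro x hx I hI hIc hxI
          have hIB : I ⊆ B := by
            intro y hy
            rcases Finset.mem_insert.mp (hI hy) with rfl | h
            · exfalso
              rcases Finset.mem_insert.mp hx with h2 | h2
              · have := hxI _ hy; rw [h2] at this; exact lt_irrefl _ this
              · exact lt_asymm (hlt _ h2) (hxI _ hy)
            · exact h
          rcases Finset.mem_insert.mp hx with h2 | h2
          · simp only [h2, if_true]
            exact hc I (hIB.trans hB) hIc
          · have : x ≠ a := fun h => haB (h ▸ h2)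
            simp only [this, if_false]
            exact hχ x h2 I hIB hIc hxI
    intro m
    obtain ⟨M, hM⟩ := key (Fintype.card C * m)
    refine ⟨M, fun α _ S hS col => ?_⟩
    obtain ⟨B, hB, hBc, χ, hχ⟩ := hM α S hS col
    have : Nonempty C := ⟨col ∅⟩
    obtain ⟨c, -, hc⟩ := Finset.exists_le_card_fiber_of_mul_le_card_of_maps_to (s := B)
      (t := (Finset.univ : Finset C)) (f := χ) (n := m) (fun _ _ => Finset.mem_univ _)
      Finset.univ_nonempty (by rw [hBc]; simp)
    obtain ⟨K, hK, hKc⟩ := Finset.exists_subset_card_eq hc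
    refine ⟨K, fun x hx => hB (Finset.mem_filter.mp (hK hx)).1, hKc, c, fun I hI hIc => ?_⟩
    have hne : I.Nonempty := Finset.card_pos.mp (by omega)
    have hm := Finset.min'_mem I hne
    have h1 := hχ (I.min' hne) (Finset.mem_filter.mp (hK (hI hm))).1 (I.erase (I.min' hne))
      (fun y hy => (Finset.mem_filter.mp (hK (hI (Finset.mem_of_mem_erase hy)))).1)
      (by rw [Finset.card_erase_of_mem hm, hIc]; rfl)
      (fun b hb => by
        rw [Finset.mem_erase] at hb
        exact lt_of_le_of_ne (Finset.min'_le _ _ hb.2) (Ne.symm hb.1))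
    rw [Finset.insert_erase hm] at h1
    rw [h1]
    exact (Finset.mem_filter.mp (hK (hI hm))).2

end UTD

namespace UTD
open Finset

section reg
variable {ι : Type} [Fintype ι] [DecidableEq ι]

/-- Number of points of a box. -/
noncomputable def vol (T : ι → Finset ℕ) : ℝ := ((Fintype.piFinset T).card : ℝ)

lemma vol_eq (T : ι → Finset ℕ) : vol T = ∏ i, ((T i).card : ℝ) := by
  simp [vol, Fintype.card_piFinset]

lemma vol_nonneg (T : ι → Finset ℕ) : 0 ≤ vol T := by unfold vol; positivity

lemma vol_pos {T : ι → Finset ℕ} (h : ∀ i, (T i).Nonempty) : 0 < vol T := by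
  rw [vol_eq]; exact prod_pos fun i _ => by exact_mod_cast (h i).card_pos

lemma vol_mono {T U : ι → Finset ℕ} (h : ∀ i, U i ⊆ T i) : vol U ≤ vol T := by
  unfold vol; exact_mod_cast card_le_card (Fintype.piFinset_subset _ _ h)

lemma vol_small {T U : ι → Finset ℕ} {p : ℝ} (h : ∀ i, U i ⊆ T i) {j : ι}
    (hj : ((U j).card : ℝ) ≤ p * (T j).card) : vol U ≤ p * vol T := by
  rw [vol_eq, vol_eq, ← mul_prod_erase univ _ (mem_univ j),
    ← mul_prod_erase univ (fun i => ((T i).card : ℝ)) (mem_univ j), ← mul_assoc]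
  refine mul_le_mul hj ?_ (prod_nonneg fun i _ => by positivity) ?_
  · exact prod_le_prod (fun i _ => by positivity)
      (fun i _ => by exact_mod_cast card_le_card (h i))
  · exact le_trans (by positivity) hj

lemma vol_large {T U : ι → Finset ℕ} {c : ℝ} (hc : 0 ≤ c)
    (h : ∀ i, c * ((T i).card : ℝ) ≤ (U i).card) : c ^ Fintype.card ι * vol T ≤ vol U := by
  rw [vol_eq, vol_eq]
  calc c ^ Fintype.card ι * ∏ i, ((T i).card : ℝ) = ∏ i, (c * ((T i).card : ℝ)) := by
        rw [prod_mul_distrib, prod_const, card_univ]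
    _ ≤ _ := prod_le_prod (fun i _ => by positivity) (fun i _ => h i)

/-- Sum of `f · y` over a box. -/
noncomputable def bsum {Y : Type} (f : (ι → ℕ) → Y → ℝ) (T : ι → Finset ℕ) (y : Y) : ℝ :=
  ∑ x ∈ Fintype.piFinset T, f x y

/-- The energy of a box. -/
noncomputable def energy {Y : Type} (f : (ι → ℕ) → Y → ℝ) (Ys : Finset Y)
    (T : ι → Finset ℕ) : ℝ :=
  ∑ y ∈ Ys, (bsum f T y / vol T) ^ 2

lemma bsum_nonneg {Y : Type} {f : (ι → ℕ) → Y → ℝ} (h0 : ∀ x y, 0 ≤ f x y)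
    (T : ι → Finset ℕ) (y : Y) : 0 ≤ bsum f T y := sum_nonneg fun _ _ => h0 _ _

lemma bsum_le {Y : Type} {f : (ι → ℕ) → Y → ℝ} (h1 : ∀ x y, f x y ≤ 1)
    (T : ι → Finset ℕ) (y : Y) : bsum f T y ≤ vol T := by
  unfold bsum vol
  calc _ ≤ ∑ x ∈ Fintype.piFinset T, (1 : ℝ) := sum_le_sum fun _ _ => h1 _ _
    _ = _ := by simp

lemma energy_le {Y : Type} {f : (ι → ℕ) → Y → ℝ} (h0 : ∀ x y, 0 ≤ f x y)
    (h1 : ∀ x y, f x y ≤ 1) (Ys : Finset Y) (T : ι → Finset ℕ) :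
    energy f Ys T ≤ Ys.card := by
  unfold energy
  calc _ ≤ ∑ y ∈ Ys, (1 : ℝ) := sum_le_sum fun y _ => by
        have a := bsum_nonneg h0 T y
        have b := bsum_le h1 T y
        have c := vol_nonneg T
        have : bsum f T y / vol T ≤ 1 := div_le_one_of_le₀ b c
        have : 0 ≤ bsum f T y / vol T := by positivity
        nlinarith
    _ = _ := by simp

lemma energy_nonneg {Y : Type} (f : (ι → ℕ) → Y → ℝ) (Ys : Finset Y) (T : ι → Finset ℕ) :
    0 ≤ energy f Ys T := sum_nonneg fun _ _ => sq_nonneg _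

/-- The cell of the partition of the box `T` induced by the box `U`. -/
def cell (T U : ι → Finset ℕ) (J : Finset ι) : ι → Finset ℕ :=
  fun i => if i ∈ J then U i else T i \ U i

lemma cell_subset {T U : ι → Finset ℕ} (h : ∀ i, U i ⊆ T i) (J : Finset ι) (i : ι) :
    cell T U J i ⊆ T i := by
  unfold cell; split_ifs
  · exact h i
  · exact sdiff_subset

lemma sum_cells {T U : ι → Finset ℕ} (h : ∀ i, U i ⊆ T i) (g : (ι → ℕ) → ℝ) :
    ∑ J : Finset ι, ∑ x ∈ Fintype.piFinset (cell T U J), g x = ∑ x ∈ Fintype.piFinset T, g x := by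
  rw [← sum_fiberwise (Fintype.piFinset T) (fun x => univ.filter fun i => x i ∈ U i) g]
  refine sum_congr rfl fun J _ => sum_congr ?_ fun _ _ => rfl
  ext x
  simp only [Fintype.mem_piFinset, mem_filter, cell]
  constructor
  · intro hx
    refine ⟨fun i => ?_, ?_⟩
    · have := hx i
      split_ifs at this
      · exact h i this
      · exact (mem_sdiff.mp this).1
    · ext i
      have := hx i
      simp only [mem_filter, mem_univ, true_and]
      split_ifs at this with hi
      · exact ⟨fun _ => hi, fun _ => this⟩
      · exact ⟨fun h => absurd h (mem_sdiff.mp this).2, fun h => absurd h hi⟩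
  · rintro ⟨hx, rfl⟩ i
    simp only [mem_filter, mem_univ, true_and]
    split_ifs with hi
    · exact hi
    · exact mem_sdiff.mpr ⟨hx i, hi⟩

lemma cell_variance {κ : Type} [Fintype κ] (n a : κ → ℝ) (hn : ∀ j, 0 ≤ n j)
    (ha : ∀ j, n j = 0 → a j = 0) (N A : ℝ) (hN : 0 < N) (hnN : ∑ j, n j = N)
    (haA : ∑ j, a j = A) (j₀ : κ) :
    (a j₀ - n j₀ * (A / N)) ^ 2 ≤ N * (∑ j, n j * (a j / n j) ^ 2 - N * (A / N) ^ 2) := by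
  have hterm : ∀ j, n j * (a j / n j - A / N) ^ 2
      = n j * (a j / n j) ^ 2 - 2 * (A / N) * a j + (A / N) ^ 2 * n j := by
    intro j
    by_cases h : n j = 0
    · rw [h, ha j h]; simp
    · field_simp; ring
  have hsum : ∑ j, n j * (a j / n j - A / N) ^ 2
      = ∑ j, n j * (a j / n j) ^ 2 - N * (A / N) ^ 2 := by
    simp_rw [hterm]
    rw [sum_add_distrib, sum_sub_distrib, ← mul_sum, ← mul_sum, hnN, haA]
    field_simp; ring
  rw [← hsum]
  have h1 : n j₀ * (a j₀ / n j₀ - A / N) ^ 2 ≤ ∑ j, n j * (a j / n j - A / N) ^ 2 :=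
    single_le_sum (f := fun j => n j * (a j / n j - A / N) ^ 2)
      (fun j _ => mul_nonneg (hn j) (sq_nonneg _)) (mem_univ j₀)
  have h2 : n j₀ ≤ N := hnN ▸ single_le_sum (fun j _ => hn j) (mem_univ j₀)
  have h3 : (a j₀ - n j₀ * (A / N)) ^ 2 = n j₀ * (n j₀ * (a j₀ / n j₀ - A / N) ^ 2) := by
    by_cases h : n j₀ = 0
    · rw [h, ha j₀ h]; simp
    · field_simp
  rw [h3]
  exact mul_le_mul h2 h1 (mul_nonneg (hn _) (sq_nonneg _)) hN.le

/-- A box whose energy is nearly maximal among its large sub-boxes is regular. -/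
lemma nearMax_regular {Y : Type} {f : (ι → ℕ) → Y → ℝ} (h0 : ∀ x y, 0 ≤ f x y)
    (h1 : ∀ x y, f x y ≤ 1) (Ys : Finset Y) {T : ι → Finset ℕ} (hT : ∀ i, (T i).Nonempty)
    {p δ η : ℝ} (hp : 0 ≤ p) (hδ : 0 ≤ δ) (hη : 0 ≤ η)
    (hsum : δ + 2 ^ Fintype.card ι * p ≤ η ^ 2)
    (hmax : ∀ S : ι → Finset ℕ, (∀ i, S i ⊆ T i) → (∀ i, p * (T i).card ≤ ((S i).card : ℝ)) →
      energy f Ys S ≤ energy f Ys T + δ * Ys.card)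
    (U : ι → Finset ℕ) (hU : ∀ i, U i ⊆ T i) :
    ∑ y ∈ Ys, |bsum f U y - vol U * (bsum f T y / vol T)| ≤ η * vol T * Ys.card := by
  have hV := vol_pos hT
  have hn : ∑ J : Finset ι, vol (cell T U J) = vol T := by
    have := sum_cells hU (fun _ => (1 : ℝ))
    simpa [vol] using this
  have ha : ∀ y, ∑ J : Finset ι, bsum f (cell T U J) y = bsum f T y :=
    fun y => sum_cells hU (fun x => f x y)
  have hcU : cell T U univ = U := by ext i; simp [cell]
  have hvar : ∀ y, (bsum f U y - vol U * (bsum f T y / vol T)) ^ 2 ≤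
      vol T * (∑ J : Finset ι, vol (cell T U J) * (bsum f (cell T U J) y / vol (cell T U J)) ^ 2
        - vol T * (bsum f T y / vol T) ^ 2) := by
    intro y
    have := cell_variance (fun J : Finset ι => vol (cell T U J))
      (fun J => bsum f (cell T U J) y) (fun J => vol_nonneg _)
      (fun J hJ => le_antisymm (hJ ▸ bsum_le h1 _ _) (bsum_nonneg h0 _ _)) (vol T) _ hV hn (ha y)
      univ
    simpa only [hcU] using this
  have hcell : ∀ J : Finset ι, vol (cell T U J) * energy f Ys (cell T U J) ≤
      vol (cell T U J) * (energy f Ys T + δ * Ys.card) + p * vol T * Ys.card := by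
    intro J
    by_cases h : ∀ i, p * (T i).card ≤ ((cell T U J i).card : ℝ)
    · have := mul_le_mul_of_nonneg_left (hmax _ (cell_subset hU J) h) (vol_nonneg (cell T U J))
      have h3 : 0 ≤ p * vol T * Ys.card := by have := vol_nonneg T; positivity
      linarith
    · push Not at h
      obtain ⟨i, hi⟩ := h
      have h2 := vol_small (cell_subset hU J) hi.le
      have h3 := energy_le h0 h1 Ys (cell T U J)
      have h4 := energy_nonneg f Ys T
      have h5 := mul_le_mul h2 h3 (energy_nonneg f Ys _) (by have := vol_nonneg T; positivity)
      have h6 : 0 ≤ vol (cell T U J) * (energy f Ys T + δ * Ys.card) := by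
        have := vol_nonneg (cell T U J); positivity
      linarith
  have hsq : ∑ y ∈ Ys, (bsum f U y - vol U * (bsum f T y / vol T)) ^ 2 ≤
      (η * vol T) ^ 2 * Ys.card := by
    calc _ ≤ ∑ y ∈ Ys, vol T * (∑ J : Finset ι,
          vol (cell T U J) * (bsum f (cell T U J) y / vol (cell T U J)) ^ 2
            - vol T * (bsum f T y / vol T) ^ 2) := sum_le_sum fun y _ => hvar y
      _ = vol T * (∑ J : Finset ι, vol (cell T U J) * energy f Ys (cell T U J)
            - vol T * energy f Ys T) := by
          rw [← mul_sum, sum_sub_distrib, sum_comm]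
          simp only [energy, mul_sum]
      _ ≤ vol T * (∑ J : Finset ι, (vol (cell T U J) * (energy f Ys T + δ * Ys.card)
            + p * vol T * Ys.card) - vol T * energy f Ys T) := by
          gcongr with J _
          exact hcell J
      _ = vol T ^ 2 * Ys.card * (δ + 2 ^ Fintype.card ι * p) := by
          rw [sum_add_distrib, ← sum_mul, hn]
          simp
          ring
      _ ≤ vol T ^ 2 * Ys.card * η ^ 2 := by gcongr
      _ = _ := by ring
  have hcs := sq_sum_le_card_mul_sum_sq (s := Ys)
    (f := fun y => |bsum f U y - vol U * (bsum f T y / vol T)|)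
  simp only [sq_abs] at hcs
  refine le_of_sq_le_sq ?_ (by positivity)
  calc _ ≤ _ := hcs
    _ ≤ (Ys.card : ℝ) * ((η * vol T) ^ 2 * Ys.card) := by gcongr
    _ = _ := by ring

lemma exists_nearMax {Y : Type} {f : (ι → ℕ) → Y → ℝ} (h0 : ∀ x y, 0 ≤ f x y)
    (h1 : ∀ x y, f x y ≤ 1) (Ys : Finset Y) {p δ : ℝ} (hp : 0 < p) (hp1 : p ≤ 1)
    (j : ℕ) : ∀ T : ι → Finset ℕ, (∀ i, (T i).Nonempty) →
      (1 - j * δ) * Ys.card < energy f Ys T →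
      ∃ T' : ι → Finset ℕ, (∀ i, T' i ⊆ T i) ∧ (∀ i, (T' i).Nonempty) ∧
        (∀ i, p ^ j * (T i).card ≤ ((T' i).card : ℝ)) ∧
        (∀ S : ι → Finset ℕ, (∀ i, S i ⊆ T' i) →
          (∀ i, p * (T' i).card ≤ ((S i).card : ℝ)) →
          energy f Ys S ≤ energy f Ys T' + δ * Ys.card) := by
  induction j with
  | zero =>
    intro T _ h
    have := energy_le h0 h1 Ys T
    simp at h
    linarith
  | succ j ih =>
    intro T hT h
    by_cases hm : ∀ S : ι → Finset ℕ, (∀ i, S i ⊆ T i) →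
          (∀ i, p * (T i).card ≤ ((S i).card : ℝ)) →
          energy f Ys S ≤ energy f Ys T + δ * Ys.card
    · refine ⟨T, fun _ => subset_rfl, hT, fun i => ?_, hm⟩
      have : p ^ (j + 1) ≤ 1 := pow_le_one₀ hp.le hp1
      have h2 : (0 : ℝ) ≤ (T i).card := by positivity
      nlinarith
    · push Not at hm
      obtain ⟨S, hS, hSc, hSe⟩ := hm
      have hSn : ∀ i, (S i).Nonempty := fun i => by
        have h2 : (0 : ℝ) < (T i).card := by exact_mod_cast (hT i).card_pos
        have := lt_of_lt_of_le (mul_pos hp h2) (hSc i)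
        exact card_pos.mp (by exact_mod_cast this)
      obtain ⟨T', hT', hn, hc, hmax⟩ := ih S hSn (by push_cast at h; nlinarith)
      refine ⟨T', fun i => (hT' i).trans (hS i), hn, fun i => ?_, hmax⟩
      calc p ^ (j + 1) * (T i).card = p ^ j * (p * (T i).card) := by ring
        _ ≤ p ^ j * (S i).card := by gcongr; exact hSc i
        _ ≤ _ := hc i

lemma exists_regular (ι : Type) [Fintype ι] [DecidableEq ι] (η : ℝ) (hη : 0 < η) :
    ∃ c : ℝ, 0 < c ∧ c ≤ 1 ∧ ∀ (Y : Type) (f : (ι → ℕ) → Y → ℝ), (∀ x y, 0 ≤ f x y) →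
      (∀ x y, f x y ≤ 1) → ∀ (Ys : Finset Y), Ys.Nonempty → ∀ T : ι → Finset ℕ,
      (∀ i, (T i).Nonempty) →
      ∃ T' : ι → Finset ℕ, (∀ i, T' i ⊆ T i) ∧ (∀ i, (T' i).Nonempty) ∧
        (∀ i, c * (T i).card ≤ ((T' i).card : ℝ)) ∧
        ∀ U : ι → Finset ℕ, (∀ i, U i ⊆ T' i) →
          ∑ y ∈ Ys, |bsum f U y - vol U * (bsum f T' y / vol T')| ≤ η * vol T' * Ys.card := by
  set P : ℝ := 2 ^ Fintype.card ι with hP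
  have hPpos : 0 < P := by positivity
  set p : ℝ := min 1 (η ^ 2 / 2 / P) with hp
  have hp0 : 0 < p := by positivity
  have hp1 : p ≤ 1 := min_le_left _ _
  have hpP : P * p ≤ η ^ 2 / 2 := by
    have : p ≤ η ^ 2 / 2 / P := min_le_right _ _
    rw [le_div_iff₀ hPpos] at this; linarith
  obtain ⟨j, hj⟩ := exists_nat_gt (1 / (η ^ 2 / 2))
  have hj' : 1 < j * (η ^ 2 / 2) := by rwa [div_lt_iff₀ (by positivity)] at hj
  refine ⟨p ^ j, by positivity, pow_le_one₀ hp0.le hp1, fun Y f h0 h1 Ys hYs T hT => ?_⟩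
  have hY : (0 : ℝ) < Ys.card := by exact_mod_cast hYs.card_pos
  obtain ⟨T', a, b, c, d⟩ := exists_nearMax h0 h1 Ys hp0 hp1 (δ := η ^ 2 / 2) j T hT
    (by have := energy_nonneg f Ys T; nlinarith)
  exact ⟨T', a, b, c, fun U hU => nearMax_regular h0 h1 Ys b hp0.le (by positivity) hη.le
    (by rw [← hP]; linarith) d U hU⟩

end reg
end UTD

namespace UTD
open Finset

section reg2
variable {ι : Type} [Fintype ι] [DecidableEq ι]

lemma pw_mem {S T : ι → Finset ℕ} {L : Finset ι} {x y : ι → ℕ}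
    (hx : x ∈ Fintype.piFinset S) (hy : y ∈ Fintype.piFinset T) :
    L.piecewise x y ∈ Fintype.piFinset (L.piecewise S T) := by
  rw [Fintype.mem_piFinset] at *
  intro i
  by_cases h : i ∈ L
  · simpa [h] using hx i
  · simpa [h] using hy i

lemma pw_pw {β : Type} (L : Finset ι) (x y : ι → β) :
    L.piecewise (L.piecewise x y) (L.piecewise y x) = x := by
  ext i; by_cases h : i ∈ L <;> simp [h]

/-- Exchanging the coordinates in `L` between two points of boxes. -/
lemma sum_swap (S T : ι → Finset ℕ) (L : Finset ι) (G : (ι → ℕ) → ℝ) :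
    ∑ y ∈ Fintype.piFinset T, ∑ x ∈ Fintype.piFinset S, G (L.piecewise x y)
      = vol (L.piecewise T S) * ∑ z ∈ Fintype.piFinset (L.piecewise S T), G z := by
  have h : vol (L.piecewise T S) * ∑ z ∈ Fintype.piFinset (L.piecewise S T), G z =
      ∑ q ∈ Fintype.piFinset (L.piecewise T S) ×ˢ Fintype.piFinset (L.piecewise S T), G q.2 := by
    rw [sum_product]; simp [vol]
  rw [h, ← sum_product']
  refine sum_nbij' (fun q => (L.piecewise q.1 q.2, L.piecewise q.2 q.1))
    (fun q => (L.piecewise q.1 q.2, L.piecewise q.2 q.1)) ?_ ?_ ?_ ?_ ?_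
  · rintro ⟨y, x⟩ h
    rw [mem_product] at h ⊢
    exact ⟨pw_mem h.1 h.2, pw_mem h.2 h.1⟩
  · rintro ⟨y, x⟩ h
    rw [mem_product] at h ⊢
    have h1 := pw_mem (L := L) h.1 h.2
    have h2 := pw_mem (L := L) h.2 h.1
    rw [pw_pw] at h1 h2
    exact ⟨h1, h2⟩
  · rintro ⟨y, x⟩ h; simp only [pw_pw]
  · rintro ⟨y, x⟩ h; simp only [pw_pw]
  · rintro ⟨y, x⟩ h; rfl

lemma vol_swap (S T : ι → Finset ℕ) (L : Finset ι) :
    vol (L.piecewise S T) * vol (L.piecewise T S) = vol S * vol T := by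
  rw [vol_eq, vol_eq, vol_eq, vol_eq, ← prod_mul_distrib, ← prod_mul_distrib]
  refine prod_congr rfl fun i _ => ?_
  by_cases h : i ∈ L <;> simp [h, mul_comm]

/-- `h` depends only on the coordinates in `D`. -/
def Dep {β : Type} (h : (ι → ℕ) → β) (D : Finset ι) : Prop :=
  ∀ x y : ι → ℕ, (∀ i ∈ D, x i = y i) → h x = h y

open Classical in
/-- `f` is approximated by `W` on the box `T`, as far as tests that are products of functions
of one coordinate in `L` and a function of the coordinates outside `L` can see. -/
def Reg (T : ι → Finset ℕ) (f W : (ι → ℕ) → ℝ) (L : Finset ι) (η : ℝ) : Prop :=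
  ∀ (U : ι → Set ℕ) (g : (ι → ℕ) → Prop), Dep g Lᶜ →
    |∑ x ∈ (Fintype.piFinset T).filter (fun x => g x ∧ ∀ i ∈ L, x i ∈ U i), (f x - W x)|
      ≤ η * vol T

/-- Properties of the approximating function. -/
def Approx (f W : (ι → ℕ) → ℝ) (L : Finset ι) : Prop :=
  (∀ x, 0 ≤ W x) ∧ (∀ x, W x ≤ 1) ∧ ∀ D, Dep f D → Dep W (D \ L)

lemma Reg.mono {T T' : ι → Finset ℕ} {f W : (ι → ℕ) → ℝ} {L : Finset ι} {η c : ℝ} (hc : 0 < c)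
    (hη : 0 ≤ η)
    (h : Reg T f W L (η * c ^ Fintype.card ι)) (hT : ∀ i, T' i ⊆ T i)
    (hcard : ∀ i, c * ((T i).card : ℝ) ≤ (T' i).card) : Reg T' f W L η := by
  classical
  intro U g hg
  have h1 := h (fun i => U i ∩ T' i) (fun x => g x ∧ ∀ i ∈ Lᶜ, x i ∈ T' i) ?_
  · have h2 := vol_large hc.le hcard
    have h3 : (Fintype.piFinset T).filter (fun x => (g x ∧ ∀ i ∈ Lᶜ, x i ∈ T' i) ∧
        ∀ i ∈ L, x i ∈ U i ∩ ↑(T' i)) =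
        (Fintype.piFinset T').filter (fun x => g x ∧ ∀ i ∈ L, x i ∈ U i) := by
      ext x
      simp only [mem_filter, Fintype.mem_piFinset, mem_compl, Set.mem_inter_iff, mem_coe]
      constructor
      · rintro ⟨_, ⟨a, b⟩, c⟩
        refine ⟨fun i => ?_, a, fun i hi => (c i hi).1⟩
        by_cases hi : i ∈ L
        · exact (c i hi).2
        · exact b i hi
      · rintro ⟨a, b, c⟩
        exact ⟨fun i => hT i (a i), ⟨b, fun i _ => a i⟩, fun i hi => ⟨c i hi, a i⟩⟩
    have h4 : |∑ x ∈ (Fintype.piFinset T').filter (fun x => g x ∧ ∀ i ∈ L, x i ∈ U i),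
        (f x - W x)| ≤ η * c ^ Fintype.card ι * vol T := by
      rw [← h3]; convert h1
    calc _ ≤ _ := by convert h4
      _ = η * (c ^ Fintype.card ι * vol T) := by ring
      _ ≤ _ := by gcongr
  · intro x y hxy
    have e1 := hg x y hxy
    simp only [e1]
    congr 1
    apply propext
    exact forall₂_congr fun i hi => by rw [hxy i hi]

lemma exists_reg_one (ι : Type) [Fintype ι] [DecidableEq ι] (η : ℝ) (hη : 0 < η) :
    ∃ c : ℝ, 0 < c ∧ c ≤ 1 ∧ ∀ (f : (ι → ℕ) → ℝ), (∀ x, 0 ≤ f x) → (∀ x, f x ≤ 1) →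
      ∀ (L : Finset ι) (T : ι → Finset ℕ), (∀ i, (T i).Nonempty) →
      ∃ T' : ι → Finset ℕ, (∀ i, T' i ⊆ T i) ∧ (∀ i, (T' i).Nonempty) ∧
        (∀ i, c * (T i).card ≤ ((T' i).card : ℝ)) ∧
        ∃ W, Approx f W L ∧ Reg T' f W L η := by
  classical
  obtain ⟨c, hc0, hc1, H⟩ := exists_regular ι η hη
  refine ⟨c, hc0, hc1, fun f h0 h1 L T hT => ?_⟩
  obtain ⟨S, hS, hSn, hSc, hreg⟩ := H (ι → ℕ) (fun x y => f (L.piecewise x y))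
    (fun _ _ => h0 _) (fun _ _ => h1 _) (Fintype.piFinset T) (by simpa using hT) T hT
  set W : (ι → ℕ) → ℝ := fun y => bsum (fun x y => f (L.piecewise x y)) S y / vol S with hW
  have hSpos := vol_pos hSn
  refine ⟨L.piecewise S T, ?_, ?_, ?_, W, ⟨?_, ?_, ?_⟩, ?_⟩
  · intro i; by_cases h : i ∈ L <;> simp [h, hS]
  · intro i; by_cases h : i ∈ L <;> simp [h, hSn, hT]
  · intro i
    by_cases h : i ∈ L
    · simpa [h] using hSc i
    · have : (0 : ℝ) ≤ (T i).card := by positivity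
      simp only [h, not_false_eq_true, piecewise_eq_of_notMem]
      nlinarith
  · intro x; exact div_nonneg (bsum_nonneg (fun _ _ => h0 _) _ _) hSpos.le
  · intro x; exact div_le_one_of_le₀ (bsum_le (fun _ _ => h1 _) _ _) hSpos.le
  · intro D hD x y hxy
    simp only [hW, bsum]
    congr 1
    refine sum_congr rfl fun z _ => hD _ _ fun i hi => ?_
    by_cases h : i ∈ L
    · simp [h]
    · simpa [h] using hxy i (by simp [hi, h])
  · intro U g hg
    have hWL : Dep W Lᶜ := by
      intro x y hxy
      simp only [hW, bsum]
      congr 1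
      refine sum_congr rfl fun z _ => ?_
      congr 1
      ext i
      by_cases h : i ∈ L
      · simp [h]
      · simpa [h] using hxy i (by simp [h])
    set u : ι → Finset ℕ := L.piecewise (fun i => (S i).filter (· ∈ U i)) S with hu
    have huS : ∀ i, u i ⊆ S i := by
      intro i; by_cases h : i ∈ L <;> simp [hu, h, filter_subset]
    have h2 := hreg u huS
    have e1 : L.piecewise T u = L.piecewise T S := by
      ext i; by_cases h : i ∈ L <;> simp [hu, h]
    set G : (ι → ℕ) → ℝ := fun z => if g z then f z - W z else 0 with hG
    have e2 : ∑ z ∈ Fintype.piFinset (L.piecewise u T), G z =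
        ∑ x ∈ (Fintype.piFinset (L.piecewise S T)).filter
          (fun x => g x ∧ ∀ i ∈ L, x i ∈ U i), (f x - W x) := by
      rw [hG, ← sum_filter]
      refine sum_congr ?_ fun _ _ => rfl
      ext x
      simp only [mem_filter, Fintype.mem_piFinset]
      constructor
      · rintro ⟨a, b⟩
        refine ⟨fun i => ?_, b, fun i hi => ?_⟩
        · have := a i
          by_cases h : i ∈ L
          · simp [hu, h] at this ⊢; exact this.1
          · simpa [h] using this
        · have := a i
          simp [hu, hi] at this; exact this.2
      · rintro ⟨a, b, c⟩
        refine ⟨fun i => ?_, b⟩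
        have := a i
        by_cases h : i ∈ L
        · simp [hu, h] at this ⊢; exact ⟨this, c i h⟩
        · simpa [h] using this
    have e3 := sum_swap u T L G
    rw [e1, e2] at e3
    have e4 : ∀ y, ∑ x ∈ Fintype.piFinset u, G (L.piecewise x y) =
        if g y then bsum (fun x y => f (L.piecewise x y)) u y - vol u * W y else 0 := by
      intro y
      have a1 : ∀ x, g (L.piecewise x y) = g y := fun x => hg _ _ fun i hi => by
        have : i ∉ L := by simpa using hi
        simp [this]
      have a2 : ∀ x, W (L.piecewise x y) = W y := fun x => hWL _ _ fun i hi => by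
        have : i ∉ L := by simpa using hi
        simp [this]
      simp only [hG, a1, a2]
      split_ifs
      · rw [sum_sub_distrib]; simp [bsum, vol]
      · simp
    have e5 : |vol (L.piecewise T S) * ∑ x ∈ (Fintype.piFinset (L.piecewise S T)).filter
          (fun x => g x ∧ ∀ i ∈ L, x i ∈ U i), (f x - W x)| ≤ η * vol S * vol T := by
      rw [← e3]
      refine (abs_sum_le_sum_abs _ _).trans (le_trans (sum_le_sum fun y _ => ?_) h2)
      rw [e4]
      split_ifs
      · exact le_rfl
      · simp
    have hpos : 0 < vol (L.piecewise T S) := vol_pos fun i => by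
      by_cases h : i ∈ L <;> simp [h, hSn, hT]
    rw [abs_mul, abs_of_pos hpos, mul_assoc, ← vol_swap S T L] at e5
    refine le_of_mul_le_mul_left ?_ hpos
    calc _ ≤ _ := e5
      _ = _ := by ring

lemma exists_reg_list (ι : Type) [Fintype ι] [DecidableEq ι] (n : ℕ) : ∀ (η : ℝ), 0 < η →
    ∃ c : ℝ, 0 < c ∧ c ≤ 1 ∧ ∀ l : List (((ι → ℕ) → ℝ) × Finset ι), l.length = n →
      (∀ q ∈ l, ∀ x, 0 ≤ q.1 x ∧ q.1 x ≤ 1) →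
      ∀ (T : ι → Finset ℕ), (∀ i, (T i).Nonempty) →
      ∃ T' : ι → Finset ℕ, (∀ i, T' i ⊆ T i) ∧ (∀ i, (T' i).Nonempty) ∧
        (∀ i, c * (T i).card ≤ ((T' i).card : ℝ)) ∧
        ∀ q ∈ l, ∃ W, Approx q.1 W q.2 ∧ Reg T' q.1 W q.2 η := by
  induction n with
  | zero =>
    intro η hη
    refine ⟨1, one_pos, le_rfl, fun l hl _ T hT => ⟨T, fun _ => subset_rfl, hT, by simp, ?_⟩⟩
    rw [List.length_eq_zero_iff.mp hl]; simp
  | succ n ih =>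
    intro η hη
    obtain ⟨c, hc0, hc1, hc⟩ := ih η hη
    obtain ⟨d, hd0, hd1, hd⟩ := exists_reg_one ι (η * c ^ Fintype.card ι) (by positivity)
    refine ⟨c * d, by positivity, mul_le_one₀ hc1 hd0.le hd1, fun l hl hl1 T hT => ?_⟩
    match l, hl, hl1 with
    | [], hl, _ => simp at hl
    | q :: l, hl, hl1 =>
      obtain ⟨T1, a1, a2, a3, W, a4, a5⟩ := hd q.1 (fun x => (hl1 q (by simp) x).1)
        (fun x => (hl1 q (by simp) x).2) q.2 T hT
      obtain ⟨T2, b1, b2, b3, b4⟩ := hc l (by simpa using hl)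
        (fun q' hq' => hl1 q' (by simp [hq'])) T1 a2
      refine ⟨T2, fun i => (b1 i).trans (a1 i), b2, fun i => ?_, ?_⟩
      · calc c * d * (T i).card = c * (d * (T i).card) := by ring
          _ ≤ c * (T1 i).card := by gcongr; exact a3 i
          _ ≤ _ := b3 i
      · intro q' hq'
        rcases List.mem_cons.mp hq' with rfl | h
        · exact ⟨W, a4, a5.mono hc0 hη.le b1 b3⟩
        · exact b4 q' h

/-- Family version. -/
lemma exists_reg_family (ι κ : Type) [Fintype ι] [DecidableEq ι] [Fintype κ] (η : ℝ) (hη : 0 < η) :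
    ∃ c : ℝ, 0 < c ∧ c ≤ 1 ∧ ∀ (f : κ → (ι → ℕ) → ℝ) (L : κ → Finset ι),
      (∀ q x, 0 ≤ f q x ∧ f q x ≤ 1) →
      ∀ (T : ι → Finset ℕ), (∀ i, (T i).Nonempty) →
      ∃ T' : ι → Finset ℕ, (∀ i, T' i ⊆ T i) ∧ (∀ i, (T' i).Nonempty) ∧
        (∀ i, c * (T i).card ≤ ((T' i).card : ℝ)) ∧
        ∀ q, ∃ W, Approx (f q) W (L q) ∧ Reg T' (f q) W (L q) η := by
  obtain ⟨c, hc0, hc1, hc⟩ := exists_reg_list ι (Fintype.card κ) η hη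
  refine ⟨c, hc0, hc1, fun f L hf T hT => ?_⟩
  obtain ⟨T', a, b, d, e⟩ := hc ((univ : Finset κ).toList.map fun q => (f q, L q)) (by simp)
    (by
      intro q hq x
      rw [List.mem_map] at hq
      obtain ⟨k, _, rfl⟩ := hq
      exact hf k x) T hT
  exact ⟨T', a, b, d, fun q => e (f q, L q) (List.mem_map.mpr ⟨q, by simp, rfl⟩)⟩

open Classical in
/-- Regularity against conjunctions of conditions meeting `I` in at most one coordinate or
avoiding `L`. -/
lemma Reg.strong {T : ι → Finset ℕ} {f W : (ι → ℕ) → ℝ} {L I : Finset ι} {η : ℝ}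
    (hT : ∀ i, (T i).Nonempty)
    (h : Reg T f W L η) (hLI : L ⊆ I) (hf : Dep f I) (hW : Dep W I)
    {κ : Type} (φ : κ → (ι → ℕ) → Prop) (D : κ → Finset ι) (hφ : ∀ j, Dep (φ j) (D j))
    (hD : ∀ j, Disjoint (D j) L ∨ (D j ∩ I).card ≤ 1) :
    |∑ x ∈ (Fintype.piFinset T).filter (fun x => ∀ j, φ j x), (f x - W x)| ≤ η * vol T := by
  have hpos := vol_pos hT
  set G : (ι → ℕ) → ℝ := fun z => if ∀ j, φ j z then f z - W z else 0 with hG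
  have e1 : ∑ x ∈ (Fintype.piFinset T).filter (fun x => ∀ j, φ j x), (f x - W x) =
      ∑ x ∈ Fintype.piFinset T, G x := by rw [hG, ← sum_filter]
  have e2 := sum_swap T T I G
  have e3 : I.piecewise T T = T := by funext i; by_cases hi : i ∈ I <;> simp [hi]
  rw [e3, ← e1] at e2
  have e4 : ∀ o, |∑ x ∈ Fintype.piFinset T, G (I.piecewise x o)| ≤ η * vol T := by
    intro o
    have h1 := h (fun i => {v | ∀ j, i ∈ D j → (D j ∩ I).card ≤ 1 → φ j (Function.update o i v)})
      (fun z => ∀ j, Disjoint (D j) L → φ j (I.piecewise z o)) ?_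
    · convert h1 using 2
      simp only [hG]
      rw [← sum_filter]
      refine sum_congr ?_ ?_
      · ext x
        simp only [mem_filter, Set.mem_ofPred_eq]
        refine and_congr_right fun _ => ?_
        have key : ∀ j, ∀ i ∈ L, i ∈ D j → (D j ∩ I).card ≤ 1 →
            (φ j (I.piecewise x o) = φ j (Function.update o i (x i))) := by
          intro j i hi hij hc
          refine hφ j _ _ fun k hk => ?_
          by_cases hki : k = i
          · subst hki; simp [hLI hi]
          · have hkI : k ∉ I := fun hkI => hki (card_le_one.mp hc k (mem_inter.mpr ⟨hk, hkI⟩) i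
              (mem_inter.mpr ⟨hij, hLI hi⟩))
            simp [hki, hkI]
        constructor
        · intro hx
          refine ⟨fun j _ => hx j, fun i hi j hij hc => ?_⟩
          rw [← key j i hi hij hc]; exact hx j
        · rintro ⟨ha, hb⟩ j
          by_cases hd : Disjoint (D j) L
          · exact ha j hd
          · have hc := (hD j).resolve_left hd
            rw [not_disjoint_iff] at hd
            obtain ⟨i, hij, hi⟩ := hd
            rw [key j i hi hij hc]; exact hb i hi j hij hc
      · intro x _
        rw [hf (I.piecewise x o) x fun i hi => by simp [hi],
          hW (I.piecewise x o) x fun i hi => by simp [hi]]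
    · intro x y hxy
      apply propext
      refine forall₂_congr fun j hj => ?_
      rw [hφ j (I.piecewise x o) (I.piecewise y o) fun i hi => ?_]
      by_cases hiI : i ∈ I
      · have : i ∉ L := fun hL => (disjoint_left.mp hj hi) hL
        simpa [hiI] using hxy i (by simpa using this)
      · simp [hiI]
  have e5 : vol T * |∑ x ∈ (Fintype.piFinset T).filter (fun x => ∀ j, φ j x), (f x - W x)|
      ≤ vol T * (η * vol T) := by
    rw [← abs_of_pos hpos, ← abs_mul, abs_of_pos hpos, ← e2]
    refine (abs_sum_le_sum_abs _ _).trans ((sum_le_sum fun o _ => e4 o).trans ?_)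
    simp [vol]
  exact le_of_mul_le_mul_left e5 hpos

end reg2
end UTD

namespace UTD
open Finset

section cnt
variable {ι : Type} [Fintype ι] [DecidableEq ι]

open Classical in
/-- Indicator of a predicate. -/
noncomputable def ind (P : (ι → ℕ) → Prop) (x : ι → ℕ) : ℝ := if P x then 1 else 0

open Classical in
/-- Number of points of a box satisfying a predicate. -/
noncomputable def cnt (T : ι → Finset ℕ) (P : (ι → ℕ) → Prop) : ℝ :=
  (((Fintype.piFinset T).filter P).card : ℝ)

lemma cnt_eq (T : ι → Finset ℕ) (P : (ι → ℕ) → Prop) :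
    cnt T P = ∑ x ∈ Fintype.piFinset T, ind P x := by
  simp [cnt, ind]

lemma ind_nonneg (P : (ι → ℕ) → Prop) (x : ι → ℕ) : 0 ≤ ind P x := by
  unfold ind; split_ifs <;> norm_num

lemma ind_le (P : (ι → ℕ) → Prop) (x : ι → ℕ) : ind P x ≤ 1 := by
  unfold ind; split_ifs <;> norm_num

lemma Dep.ind {P : (ι → ℕ) → Prop} {D : Finset ι} (h : Dep P D) : Dep (ind P) D := by
  intro x y hxy
  unfold UTD.ind
  rw [h x y hxy]

lemma Dep.mono {β : Type} {P : (ι → ℕ) → β} {D D' : Finset ι} (h : Dep P D) (hD : D ⊆ D') :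
    Dep P D' := fun x y hxy => h x y fun i hi => hxy i (hD hi)

lemma chain_step {T : ι → Finset ℕ} (hT : ∀ i, (T i).Nonempty) {P B : (ι → ℕ) → Prop}
    {W : (ι → ℕ) → ℝ} {L I : Finset ι} {η δ : ℝ}
    (h : Reg T (ind P) W L η) (hLI : L ⊆ I) (hf : Dep P I) (hW : Dep W I)
    (hW0 : ∀ x, 0 ≤ W x) (hB : ∀ x, B x → δ ≤ W x)
    {κ : Type} (φ : κ → (ι → ℕ) → Prop) (D : κ → Finset ι) (hφ : ∀ j, Dep (φ j) (D j))
    (hD : ∀ j, Disjoint (D j) L ∨ (D j ∩ I).card ≤ 1) :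
    δ * cnt T (fun x => B x ∧ ∀ j, φ j x) - η * vol T ≤ cnt T (fun x => P x ∧ ∀ j, φ j x) := by
  classical
  have h1 := (abs_le.mp (h.strong hT hLI hf.ind hW φ D hφ hD)).1
  rw [sum_sub_distrib] at h1
  have h2 : cnt T (fun x => P x ∧ ∀ j, φ j x) =
      ∑ x ∈ (Fintype.piFinset T).filter (fun x => ∀ j, φ j x), ind P x := by
    rw [cnt_eq, sum_filter]
    refine sum_congr rfl fun x _ => ?_
    by_cases a : P x <;> by_cases b : ∀ j, φ j x <;> simp [ind, a, b]
  have h3 : cnt T (fun x => B x ∧ ∀ j, φ j x) =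
      ∑ x ∈ (Fintype.piFinset T).filter (fun x => ∀ j, φ j x), ind B x := by
    rw [cnt_eq, sum_filter]
    refine sum_congr rfl fun x _ => ?_
    by_cases a : B x <;> by_cases b : ∀ j, φ j x <;> simp [ind, a, b]
  have h4 : δ * ∑ x ∈ (Fintype.piFinset T).filter (fun x => ∀ j, φ j x), ind B x ≤
      ∑ x ∈ (Fintype.piFinset T).filter (fun x => ∀ j, φ j x), W x := by
    rw [mul_sum]
    refine sum_le_sum fun x _ => ?_
    by_cases a : B x
    · simpa [ind, a] using hB x a
    · simpa [ind, a] using hW0 x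
  rw [h2, h3]
  linarith

lemma chain {E : Type} [DecidableEq E] {T : ι → Finset ℕ} (hT : ∀ i, (T i).Nonempty)
    (J : Finset E) (P B : E → (ι → ℕ) → Prop) (W : E → (ι → ℕ) → ℝ) (L D : E → Finset ι)
    {η δ : ℝ} (hη : 0 ≤ η) (hδ : 0 ≤ δ) (hδ1 : δ ≤ 1)
    (h : ∀ j ∈ J, Reg T (ind (P j)) (W j) (L j) η) (hL : ∀ j ∈ J, L j ⊆ D j)
    (hP : ∀ j ∈ J, Dep (P j) (D j)) (hB : ∀ j ∈ J, Dep (B j) (D j))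
    (hW : ∀ j ∈ J, Dep (W j) (D j)) (hW0 : ∀ j ∈ J, ∀ x, 0 ≤ W j x)
    (hBW : ∀ j ∈ J, ∀ x, B j x → δ ≤ W j x)
    (hD : ∀ i ∈ J, ∀ j ∈ J, i ≠ j → Disjoint (D i) (L j) ∨ (D i ∩ D j).card ≤ 1) :
    δ ^ J.card * cnt T (fun x => ∀ j ∈ J, B j x) - J.card * (η * vol T) ≤
      cnt T (fun x => ∀ j ∈ J, P j x) := by
  classical
  have hV := vol_nonneg T
  have key : ∀ J' ⊆ J, δ ^ J'.card * cnt T (fun x => ∀ j ∈ J, if j ∈ J' then B j x else P j x)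
      - J'.card * (η * vol T) ≤ cnt T (fun x => ∀ j ∈ J, P j x) := by
    intro J'
    induction J' using Finset.induction_on with
    | empty => intro _; simp
    | insert a J' ha ih =>
      intro hs
      have haJ : a ∈ J := hs (mem_insert_self _ _)
      have ih' := ih fun x hx => hs (mem_insert_of_mem hx)
      have st := chain_step hT (h a haJ) (hL a haJ) (hP a haJ) (hW a haJ) (hW0 a haJ) (hBW a haJ)
        (κ := {j // j ∈ J ∧ j ≠ a}) (fun j x => if j.1 ∈ J' then B j.1 x else P j.1 x)
        (fun j => D j.1) (by
          rintro ⟨j, hj, hja⟩ x y hxy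
          dsimp only
          rw [hB j hj x y hxy, hP j hj x y hxy]) (by
          rintro ⟨j, hj, hja⟩
          exact hD j hj a haJ hja)
      have e1 : (fun x => P a x ∧ ∀ j : {j // j ∈ J ∧ j ≠ a},
          if j.1 ∈ J' then B j.1 x else P j.1 x) =
          fun x => ∀ j ∈ J, if j ∈ J' then B j x else P j x := by
        funext x
        apply propext
        constructor
        · rintro ⟨a1, a2⟩ j hj
          by_cases hja : j = a
          · subst hja; simpa [ha] using a1
          · exact a2 ⟨j, hj, hja⟩
        · intro a1
          exact ⟨by simpa [ha] using a1 a haJ, fun j => a1 j.1 j.2.1⟩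
      have e2 : (fun x => B a x ∧ ∀ j : {j // j ∈ J ∧ j ≠ a},
          if j.1 ∈ J' then B j.1 x else P j.1 x) =
          fun x => ∀ j ∈ J, if j ∈ insert a J' then B j x else P j x := by
        funext x
        apply propext
        constructor
        · rintro ⟨a1, a2⟩ j hj
          by_cases hja : j = a
          · subst hja; simpa using a1
          · simpa [hja] using a2 ⟨j, hj, hja⟩
        · intro a1
          refine ⟨by simpa using a1 a haJ, fun j => ?_⟩
          simpa [j.2.2] using a1 j.1 j.2.1
      rw [e1, e2] at st
      rw [card_insert_of_notMem ha, pow_succ]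
      have hpw : δ ^ J'.card ≤ 1 := pow_le_one₀ hδ hδ1
      have hpw0 : 0 ≤ δ ^ J'.card := by positivity
      have s2 := mul_le_mul_of_nonneg_left st hpw0
      have s3 : δ ^ J'.card * (η * vol T) ≤ η * vol T :=
        mul_le_of_le_one_left (by positivity) hpw
      push_cast
      nlinarith
  have := key J subset_rfl
  have e : (fun x => ∀ j ∈ J, if j ∈ J then B j x else P j x) = fun x => ∀ j ∈ J, B j x := by
    funext x
    apply propext
    exact forall₂_congr fun j hj => by simp [hj]
  rwa [e] at this

end cnt

section dens
variable {ι : Type} [Fintype ι] [DecidableEq ι]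

lemma avg_reduce (Ψ : (ι → ℕ) → ℝ) (s : ℕ) (hs : 1 ≤ s) (n : ℕ) :
    ∀ T : ι → Finset ℕ, (∑ i, (T i).card = n) → (∀ i, s ≤ (T i).card) →
    ∃ T' : ι → Finset ℕ, (∀ i, T' i ⊆ T i) ∧ (∀ i, (T' i).card = s) ∧
      (∑ x ∈ Fintype.piFinset T', Ψ x) * vol T ≤ (∑ x ∈ Fintype.piFinset T, Ψ x) * vol T' := by
  induction n with
  | zero =>
    intro T hn hT
    refine ⟨T, fun _ => subset_rfl, fun i => ?_, le_rfl⟩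
    have := (sum_eq_zero_iff.mp hn) i (mem_univ i)
    have := hT i
    omega
  | succ n ih =>
    intro T hn hT
    by_cases h : ∀ i, (T i).card = s
    · exact ⟨T, fun _ => subset_rfl, h, le_rfl⟩
    push Not at h
    obtain ⟨i, hi⟩ := h
    have hi' : s < (T i).card := lt_of_le_of_ne (hT i) (Ne.symm hi)
    have hne : (T i).Nonempty := card_pos.mp (by omega)
    set fib : ℕ → ℝ := fun v => ∑ x ∈ (Fintype.piFinset T).filter (fun x => x i = v), Ψ x with hfib
    obtain ⟨v, hv, hmax⟩ := exists_max_image (T i) fib hne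
    have htot : ∑ v ∈ T i, fib v = ∑ x ∈ Fintype.piFinset T, Ψ x :=
      sum_fiberwise_of_maps_to (fun x hx => (Fintype.mem_piFinset.mp hx) i) Ψ
    have hle : ∑ x ∈ Fintype.piFinset T, Ψ x ≤ (T i).card * fib v := by
      rw [← htot]
      calc _ ≤ ∑ w ∈ T i, fib v := sum_le_sum fun w hw => hmax w hw
        _ = _ := by simp
    set T1 := Function.update T i ((T i).erase v) with hT1
    have hsub : ∀ j, T1 j ⊆ T j := by
      intro j
      by_cases hj : j = i
      · subst hj; simp [hT1, erase_subset]
      · simp [hT1, hj]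
    have hT1c : ∀ j, s ≤ (T1 j).card := by
      intro j
      by_cases hj : j = i
      · subst hj; simp [hT1, card_erase_of_mem hv]; omega
      · simpa [hT1, hj] using hT j
    have hn1 : ∑ j, (T1 j).card = n := by
      rw [← add_sum_erase univ _ (mem_univ i)] at hn ⊢
      have : ∑ j ∈ univ.erase i, (T1 j).card = ∑ j ∈ univ.erase i, (T j).card :=
        sum_congr rfl fun j hj => by simp [hT1, (mem_erase.mp hj).1]
      rw [this]
      simp only [hT1, Function.update_self, card_erase_of_mem hv]
      omega
    obtain ⟨T', a, b, c⟩ := ih T1 hn1 hT1c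
    refine ⟨T', fun j => (a j).trans (hsub j), b, ?_⟩
    have hs1 : ∑ x ∈ Fintype.piFinset T1, Ψ x = ∑ x ∈ Fintype.piFinset T, Ψ x - fib v := by
      rw [eq_sub_iff_add_eq, add_comm, hfib]
      rw [← sum_filter_add_sum_filter_not (Fintype.piFinset T) (fun x => x i = v) Ψ]
      congr 1
      refine sum_congr ?_ fun _ _ => rfl
      ext x
      simp only [mem_filter, Fintype.mem_piFinset]
      constructor
      · intro hx
        refine ⟨fun j => hsub j (hx j), ?_⟩
        have := hx i
        simp [hT1] at this
        exact this.1
      · rintro ⟨hx, hxv⟩ j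
        by_cases hj : j = i
        · subst hj; simp [hT1, hx, hxv]
        · simpa [hT1, hj] using hx j
    have hTpos : ∀ j, (T j).Nonempty := fun j => card_pos.mp (by have := hT j; omega)
    have hT1pos : ∀ j, (T1 j).Nonempty := fun j => card_pos.mp (by have := hT1c j; omega)
    have hv1 : vol T1 * (T i).card = vol T * ((T i).card - 1) := by
      rw [vol_eq, vol_eq, ← mul_prod_erase univ _ (mem_univ i),
        ← mul_prod_erase univ (fun j => ((T j).card : ℝ)) (mem_univ i)]
      have : ∏ j ∈ univ.erase i, ((T1 j).card : ℝ) = ∏ j ∈ univ.erase i, ((T j).card : ℝ) :=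
        prod_congr rfl fun j hj => by simp [hT1, (mem_erase.mp hj).1]
      rw [this]
      simp only [hT1, Function.update_self, card_erase_of_mem hv]
      rw [Nat.cast_sub (by omega)]
      push_cast
      ring
    have p1 := vol_pos hT1pos
    have p2 := vol_pos hTpos
    have p3 := vol_nonneg T'
    have hk : (0 : ℝ) < (T i).card := by exact_mod_cast hne.card_pos
    set A := ∑ x ∈ Fintype.piFinset T, Ψ x
    rw [hs1] at c
    -- average does not increase when `v` is removed
    have step : (A - fib v) * vol T ≤ A * vol T1 := by
      refine le_of_mul_le_mul_right ?_ hk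
      calc (A - fib v) * vol T * (T i).card = vol T * ((T i).card * A - (T i).card * fib v) := by
            ring
        _ ≤ vol T * ((T i).card * A - A) := by gcongr
        _ = A * (vol T * ((T i).card - 1)) := by ring
        _ = A * vol T1 * (T i).card := by rw [← hv1]; ring
    refine le_of_mul_le_mul_right ?_ p1
    calc _ = ((∑ x ∈ Fintype.piFinset T', Ψ x) * vol T1) * vol T := by ring
      _ ≤ ((A - fib v) * vol T') * vol T := by gcongr
      _ = ((A - fib v) * vol T) * vol T' := by ring
      _ ≤ (A * vol T1) * vol T' := by gcongr
      _ = _ := by ring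

lemma choose_ratio (r m s : ℕ) (θ : ℝ) (hm : (r : ℝ) ^ 2 ≤ θ * m) (hrm : r ≤ m) (hm0 : 0 < m) :
    (1 - θ) * ((m * s).choose r : ℝ) ≤ (m.choose r : ℝ) * (s : ℝ) ^ r := by
  have hfac : (0 : ℝ) < (r.factorial : ℝ) := by exact_mod_cast r.factorial_pos
  have h1 : ((m * s).choose r : ℝ) * r.factorial ≤ (m : ℝ) ^ r * (s : ℝ) ^ r := by
    have := Nat.descFactorial_le_pow (m * s) r
    rw [Nat.descFactorial_eq_factorial_mul_choose] at this
    rw [← mul_pow, mul_comm]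
    exact_mod_cast this
  have h2 : ((m : ℝ) - r) ^ r ≤ (m.choose r : ℝ) * r.factorial := by
    have := Nat.pow_sub_le_descFactorial m r
    rw [Nat.descFactorial_eq_factorial_mul_choose] at this
    have h3 : (m - r) ^ r ≤ r.factorial * m.choose r :=
      le_trans (Nat.pow_le_pow_left (by omega) r) this
    rw [mul_comm, ← Nat.cast_sub hrm]
    exact_mod_cast h3
  have hmpos : (0 : ℝ) < m := by exact_mod_cast hm0
  have hrm' : (r : ℝ) ≤ m := by exact_mod_cast hrm
  have h3 : (1 - θ) * (m : ℝ) ^ r ≤ ((m : ℝ) - r) ^ r := by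
    have hb := one_add_mul_le_pow (a := -(r : ℝ) / m) (by
      rw [le_div_iff₀ hmpos]; linarith) r
    have e : ((m : ℝ) - r) ^ r = (1 + -(r : ℝ) / m) ^ r * (m : ℝ) ^ r := by
      rw [← mul_pow]; congr 1; field_simp; ring
    rw [e]
    gcongr
    refine le_trans ?_ hb
    have : (r : ℝ) ^ 2 / m ≤ θ := by rwa [div_le_iff₀ hmpos]
    have e2 : (r : ℝ) * (-(r : ℝ) / m) = - ((r : ℝ) ^ 2 / m) := by ring
    rw [e2]; linarith
  by_cases hθ : 1 - θ ≤ 0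
  · refine le_trans (mul_nonpos_of_nonpos_of_nonneg hθ (by positivity)) (by positivity)
  push Not at hθ
  refine le_of_mul_le_mul_right ?_ hfac
  calc (1 - θ) * ((m * s).choose r : ℝ) * r.factorial
      = (1 - θ) * (((m * s).choose r : ℝ) * r.factorial) := by ring
    _ ≤ (1 - θ) * ((m : ℝ) ^ r * (s : ℝ) ^ r) := by gcongr
    _ = ((1 - θ) * (m : ℝ) ^ r) * (s : ℝ) ^ r := by ring
    _ ≤ ((m.choose r : ℝ) * r.factorial) * (s : ℝ) ^ r := mul_le_mul_of_nonneg_right (h3.trans h2) (by positivity)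
    _ = _ := by ring

end dens
end UTD

namespace UTD
open Finset

section densE
variable {ι : Type} [Fintype ι] [DecidableEq ι]

lemma image_fibre {T : ι → Finset ℕ} (hd : ∀ i j, i ≠ j → Disjoint (T i) (T j)) {s : ℕ}
    (hs : ∀ i, (T i).card = s) (I : Finset ι) (Q : Finset ℕ → Prop) [DecidablePred Q] :
    ((Fintype.piFinset T).filter (fun x => Q (I.image x))).card =
      ((((Fintype.piFinset T).image (fun x => I.image x)).filter Q).card) *
        s ^ (Fintype.card ι - I.card) := by
  classical
  have key : ∀ x0 ∈ Fintype.piFinset T,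
      ((Fintype.piFinset T).filter (fun x => I.image x = I.image x0)).card =
        s ^ (Fintype.card ι - I.card) := by
    intro x0 hx0
    rw [Fintype.mem_piFinset] at hx0
    have e : (Fintype.piFinset T).filter (fun x => I.image x = I.image x0) =
        Fintype.piFinset (fun i => if i ∈ I then {x0 i} else T i) := by
      ext x
      simp only [mem_filter, Fintype.mem_piFinset]
      constructor
      · rintro ⟨h1, h2⟩ i
        by_cases hi : i ∈ I
        · simp only [hi, if_true, mem_singleton]
          have : x i ∈ I.image x0 := h2 ▸ mem_image_of_mem x hi
          obtain ⟨j, hj, hji⟩ := mem_image.mp this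
          by_cases hij : i = j
          · rw [← hji, hij]
          · exact absurd (hji ▸ hx0 j) (fun h => disjoint_left.mp (hd i j hij) (h1 i) h)
        · simpa [hi] using h1 i
      · intro h
        have hI : ∀ i ∈ I, x i = x0 i := fun i hi => by simpa [hi] using h i
        refine ⟨fun i => ?_, image_congr fun i hi => hI i hi⟩
        by_cases hi : i ∈ I
        · rw [hI i hi]; exact hx0 i
        · simpa [hi] using h i
    rw [e, Fintype.card_piFinset]
    have : ∀ i, (if i ∈ I then ({x0 i} : Finset ℕ) else T i).card = if i ∈ I then 1 else s := by
      intro i; split_ifs <;> simp [hs]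
    simp only [this]
    rw [prod_ite]
    simp only [prod_const, one_pow, one_mul]
    congr 1
    have : (univ.filter fun i => i ∉ I) = Iᶜ := by ext; simp
    rw [this, card_compl]
  rw [card_eq_sum_card_fiberwise (f := fun x => I.image x)
    (t := ((Fintype.piFinset T).image (fun x => I.image x)).filter Q)]
  · rw [sum_const_nat]
    intro e he
    obtain ⟨he, hQ⟩ := mem_filter.mp he
    obtain ⟨x0, hx0, rfl⟩ := mem_image.mp he
    rw [← key x0 hx0]
    congr 1
    ext x
    simp only [mem_filter]
    constructor
    · rintro ⟨⟨a, _⟩, b⟩; exact ⟨a, b⟩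
    · rintro ⟨a, b⟩; exact ⟨⟨a, b ▸ hQ⟩, b⟩
  · intro x hx
    have hx := mem_filter.mp hx
    exact mem_filter.mpr ⟨mem_image_of_mem _ hx.1, hx.2⟩

lemma density_lemma {r : ℕ} (H : RGraph r) {T : ι → Finset ℕ}
    (hd : ∀ i j, i ≠ j → Disjoint (T i) (T j)) (hTH : ∀ i, T i ⊆ H.verts)
    (K : Finset ι) {m s : ℕ} (hK : K.card = m) (hm0 : 0 < m) (hrm : r ≤ m) {ε ε' : ℝ} (hε : 0 < ε)
    (hε1 : ε ≤ 1) (hm : (r : ℝ) ^ 2 ≤ (ε / 4) * m) (hs : 1 ≤ s) (hsT : ∀ i, s ≤ (T i).card)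
    (hdense : IsDense H (1 / 4 + ε) ε') (hε' : ε' ≤ ε / 8)
    (hlarge : ε' * H.verts.card ≤ (m * s : ℕ)) :
    ∃ I ⊆ K, I.card = r ∧ (1 / 4 + ε / 2) * vol T ≤ cnt T (fun x => I.image x ∈ H.edges) := by
  classical
  by_contra hcon
  push Not at hcon
  set Ψ : (ι → ℕ) → ℝ := fun x => ∑ I ∈ K.powersetCard r, ind (fun x => I.image x ∈ H.edges) x
    with hΨ
  obtain ⟨T', hsub, hcard, havg⟩ := avg_reduce Ψ s hs _ T rfl hsT
  have hne : ∀ i, (T i).Nonempty := fun i => card_pos.mp (lt_of_lt_of_le hs (hsT i))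
  have hne' : ∀ i, (T' i).Nonempty := fun i => card_pos.mp (by rw [hcard]; exact hs)
  have hv := vol_pos hne
  have hv' := vol_pos hne'
  have hd' : ∀ i j, i ≠ j → Disjoint (T' i) (T' j) := fun i j hij =>
    disjoint_of_subset_left (hsub i) (disjoint_of_subset_right (hsub j) (hd i j hij))
  have hΨT : ∀ T : ι → Finset ℕ, ∑ x ∈ Fintype.piFinset T, Ψ x =
      ∑ I ∈ K.powersetCard r, cnt T (fun x => I.image x ∈ H.edges) := by
    intro T
    rw [hΨ, sum_comm]
    exact sum_congr rfl fun I _ => (cnt_eq T _).symm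
  have h1 : ∑ x ∈ Fintype.piFinset T, Ψ x ≤ (m.choose r : ℝ) * ((1 / 4 + ε / 2) * vol T) := by
    rw [hΨT]
    calc _ ≤ ∑ I ∈ K.powersetCard r, (1 / 4 + ε / 2) * vol T :=
          sum_le_sum fun I hI => (hcon I (mem_powersetCard.mp hI).1 (mem_powersetCard.mp hI).2).le
      _ = _ := by rw [sum_const, card_powersetCard, hK, nsmul_eq_mul]
  have h2 : ∑ x ∈ Fintype.piFinset T', Ψ x ≤ (m.choose r : ℝ) * ((1 / 4 + ε / 2) * vol T') := by
    refine le_of_mul_le_mul_right ?_ hv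
    calc _ ≤ _ := havg
      _ ≤ ((m.choose r : ℝ) * ((1 / 4 + ε / 2) * vol T)) * vol T' :=
          mul_le_mul_of_nonneg_right h1 hv'.le
      _ = _ := by ring
  -- translation into classes
  set 𝒞 : Finset ι → Finset (Finset ℕ) := fun I => (Fintype.piFinset T').image (fun x => I.image x)
    with h𝒞
  set N := Fintype.card ι
  have hNr : r ≤ N := hrm.trans (hK ▸ card_le_univ K)
  have hvol' : vol T' = (s : ℝ) ^ r * (s : ℝ) ^ (N - r) := by
    rw [vol_eq, ← pow_add, Nat.add_sub_cancel' hNr]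
    simp [hcard, N]
  have hspos : (0 : ℝ) < (s : ℝ) ^ (N - r) := by
    have : (0 : ℝ) < s := by exact_mod_cast hs
    positivity
  have hcE : ∀ I, I.card = r → cnt T' (fun x => I.image x ∈ H.edges) =
      (((𝒞 I).filter (· ∈ H.edges)).card : ℝ) * (s : ℝ) ^ (N - r) := by
    intro I hI
    have := image_fibre hd' hcard I (· ∈ H.edges)
    rw [hI] at this
    unfold cnt
    rw [← Nat.cast_pow, ← Nat.cast_mul, ← this]
    congr!
  have hcA : ∀ I, I.card = r → (𝒞 I).card = s ^ r := by
    intro I hI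
    have := image_fibre hd' hcard I (fun _ => True)
    simp only [filter_true] at this
    rw [hI, Fintype.card_piFinset] at this
    simp only [hcard, prod_const, card_univ] at this
    have e : s ^ Fintype.card ι = s ^ r * s ^ (N - r) := by
      rw [← pow_add, Nat.add_sub_cancel' hNr]
    rw [e] at this
    exact (Nat.eq_of_mul_eq_mul_right (by positivity) this).symm
  have h3 : ∑ I ∈ K.powersetCard r, (((𝒞 I).filter (· ∈ H.edges)).card : ℝ) ≤
      (m.choose r : ℝ) * ((1 / 4 + ε / 2) * (s : ℝ) ^ r) := by
    refine le_of_mul_le_mul_right ?_ hspos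
    rw [hΨT, hvol'] at h2
    rw [sum_mul]
    calc _ = _ := sum_congr rfl fun I hI => (hcE I (mem_powersetCard.mp hI).2).symm
      _ ≤ _ := h2
      _ = _ := by ring
  set S := K.biUnion T' with hS
  have hScard : S.card = m * s := by
    rw [hS, card_biUnion fun i _ j _ hij => hd' i j hij]
    simp [hcard, hK]
  have hSH : S ⊆ H.verts := biUnion_subset.mpr fun i _ => (hsub i).trans (hTH i)
  have h4 := hdense S hSH (by rw [hScard]; exact hlarge)
  rw [hScard] at h4
  -- union of classes
  have htrace : ∀ I ⊆ K, ∀ e ∈ 𝒞 I, I = K.filter (fun i => (e ∩ T' i).Nonempty) := by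
    intro I hI e he
    obtain ⟨x, hx, rfl⟩ := mem_image.mp he
    rw [Fintype.mem_piFinset] at hx
    ext i
    simp only [mem_filter]
    constructor
    · intro hi
      exact ⟨hI hi, x i, mem_inter.mpr ⟨mem_image_of_mem x hi, hx i⟩⟩
    · rintro ⟨_, y, hy⟩
      obtain ⟨hy, hyT⟩ := mem_inter.mp hy
      obtain ⟨j, hj, rfl⟩ := mem_image.mp hy
      by_cases hij : i = j
      · rwa [hij]
      · exact absurd (hx j) (disjoint_left.mp (hd' i j hij) hyT)
  have hdisj : ∀ I ∈ K.powersetCard r, ∀ I' ∈ K.powersetCard r, I ≠ I' →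
      Disjoint (𝒞 I) (𝒞 I') := by
    intro I hI I' hI' hne
    rw [disjoint_left]
    intro e he he'
    exact hne ((htrace I (mem_powersetCard.mp hI).1 e he).trans
      (htrace I' (mem_powersetCard.mp hI').1 e he').symm)
  set U := (K.powersetCard r).biUnion 𝒞 with hU
  have hUc : U.card = m.choose r * s ^ r := by
    rw [hU, card_biUnion hdisj, sum_congr rfl fun I hI => hcA I (mem_powersetCard.mp hI).2]
    simp [hK]
  have hUS : U ⊆ S.powersetCard r := by
    refine biUnion_subset.mpr fun I hI e he => ?_
    obtain ⟨hIK, hIr⟩ := mem_powersetCard.mp hI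
    obtain ⟨x, hx, rfl⟩ := mem_image.mp he
    rw [Fintype.mem_piFinset] at hx
    refine mem_powersetCard.mpr ⟨fun y hy => ?_, ?_⟩
    · obtain ⟨j, hj, rfl⟩ := mem_image.mp hy
      exact mem_biUnion.mpr ⟨j, hIK hj, hx j⟩
    · rw [card_image_of_injOn, hIr]
      intro i _ j _ hij
      by_contra hne
      exact disjoint_left.mp (hd' i j hne) (hx i) (by rw [hij]; exact hx j)
  have h5 : H.edges.filter (fun e => e ⊆ S) ⊆
      U.filter (· ∈ H.edges) ∪ (S.powersetCard r \ U) := by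
    intro e he
    obtain ⟨he, heS⟩ := mem_filter.mp he
    by_cases hu : e ∈ U
    · exact mem_union_left _ (mem_filter.mpr ⟨hu, he⟩)
    · exact mem_union_right _ (mem_sdiff.mpr ⟨mem_powersetCard.mpr ⟨heS, H.edges_card e he⟩, hu⟩)
  have h6 : ((H.edges.filter (fun e => e ⊆ S)).card : ℝ) ≤
      ((U.filter (· ∈ H.edges)).card : ℝ) + (((m * s).choose r : ℝ) - (m.choose r : ℝ) * (s : ℝ) ^ r) := by
    have a := (card_le_card h5).trans (card_union_le _ _)
    have b := card_sdiff_add_card_eq_card hUS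
    rw [hUc, card_powersetCard, hScard] at b
    have a' : ((H.edges.filter (fun e => e ⊆ S)).card : ℝ) ≤
      ((U.filter (· ∈ H.edges)).card : ℝ) + ((S.powersetCard r \ U).card : ℝ) := by exact_mod_cast a
    have b' : ((S.powersetCard r \ U).card : ℝ) + (m.choose r : ℝ) * (s : ℝ) ^ r =
      ((m * s).choose r : ℝ) := by exact_mod_cast b
    linarith
  have h7 : ((U.filter (· ∈ H.edges)).card : ℝ) ≤ (m.choose r : ℝ) * ((1 / 4 + ε / 2) * (s : ℝ) ^ r) := by
    refine le_trans ?_ h3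
    rw [hU, filter_biUnion]
    exact_mod_cast card_biUnion_le
  have h8 := choose_ratio r m s (ε / 4) hm hrm hm0
  have h9 : 0 < ((m * s).choose r : ℝ) := by
    have : r ≤ m * s := hrm.trans (Nat.le_mul_of_pos_right m hs)
    exact_mod_cast Nat.choose_pos this
  have h10 : (m.choose r : ℝ) * (s : ℝ) ^ r ≥ 0 := by positivity
  nlinarith [mul_le_mul_of_nonneg_right hε' h9.le, mul_le_mul_of_nonneg_left h8 (show 0 ≤ 3/4 - ε/2 by linarith), mul_pos hε h9, mul_pos (mul_pos hε hε) h9]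

end densE
end UTD

namespace UTD
open Finset

section ordG
variable {ι : Type} [LinearOrder ι]

/-- The two largest elements. -/
def tl (I : Finset ι) : Finset ι := I.filter (fun i => (I.filter (fun j => i < j)).card < 2)

/-- The two smallest elements. -/
def hd (I : Finset ι) : Finset ι := I.filter (fun i => (I.filter (fun j => j < i)).card < 2)

lemma tl_subset (I : Finset ι) : tl I ⊆ I := filter_subset _ _
lemma hd_subset (I : Finset ι) : hd I ⊆ I := filter_subset _ _

lemma tl_eq {I Z : Finset ι} (hZ : Z ⊆ I) (hc : Z.card = 2)
    (h : ∀ z ∈ Z, ∀ w ∈ I, w ∉ Z → w < z) : tl I = Z := by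
  ext i
  simp only [tl, mem_filter]
  constructor
  · rintro ⟨hi, hlt⟩
    by_contra hiZ
    have : Z ⊆ I.filter (fun j => i < j) := fun z hz =>
      mem_filter.mpr ⟨hZ hz, h z hz i hi hiZ⟩
    have := card_le_card this
    omega
  · intro hi
    refine ⟨hZ hi, ?_⟩
    have : I.filter (fun j => i < j) ⊆ Z.erase i := by
      intro j hj
      obtain ⟨hj, hij⟩ := mem_filter.mp hj
      refine mem_erase.mpr ⟨hij.ne', ?_⟩
      by_contra hjZ
      exact absurd (h i hi j hj hjZ) hij.asymm
    have := card_le_card this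
    rw [card_erase_of_mem hi] at this
    omega

lemma hd_eq {I Z : Finset ι} (hZ : Z ⊆ I) (hc : Z.card = 2)
    (h : ∀ z ∈ Z, ∀ w ∈ I, w ∉ Z → z < w) : hd I = Z :=
  tl_eq (ι := ιᵒᵈ) hZ hc h

lemma hd_inter_tl {I : Finset ι} (hI : 3 ≤ I.card) : (hd I ∩ tl I).card ≤ 1 := by
  by_contra hcon
  push Not at hcon
  obtain ⟨i, hi, j, hj, hij⟩ := one_lt_card.mp hcon
  wlog hlt : i < j generalizing i j
  · exact this j hj i hi hij.symm (lt_of_le_of_ne (not_lt.mp hlt) hij.symm)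
  simp only [hd, tl, mem_inter, mem_filter] at hi hj
  have : ({i, j} : Finset ι).card < I.card := by
    rw [card_pair hij]; omega
  obtain ⟨k, hk, hkn⟩ := exists_mem_notMem_of_card_lt_card this
  simp only [mem_insert, mem_singleton, not_or] at hkn
  rcases lt_or_gt_of_ne hkn.2 with h | h
  · have : ({i, k} : Finset ι) ⊆ I.filter (fun l => l < j) := by
      intro l hl
      simp only [mem_insert, mem_singleton] at hl
      rcases hl with rfl | rfl
      · exact mem_filter.mpr ⟨hi.1.1, hlt⟩
      · exact mem_filter.mpr ⟨hk, h⟩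
    have := card_le_card this
    rw [card_pair (Ne.symm hkn.1)] at this
    omega
  · have : ({j, k} : Finset ι) ⊆ I.filter (fun l => i < l) := by
      intro l hl
      simp only [mem_insert, mem_singleton] at hl
      rcases hl with rfl | rfl
      · exact mem_filter.mpr ⟨hj.1.1, hlt⟩
      · exact mem_filter.mpr ⟨hk, hlt.trans h⟩
    have := card_le_card this
    rw [card_pair (Ne.symm hkn.2)] at this
    omega

end ordG

lemma seq_lt {r : ℕ} {i j : Fin (2 * r - 2)} (hi : headTailSeq r i = Letter.X)
    (hj : headTailSeq r j = Letter.Z) : i < j := by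
  unfold headTailSeq at hi hj
  rw [Fin.lt_def]
  split_ifs at hi hj <;> omega

lemma seq_lt' {r : ℕ} {i j : Fin (2 * r - 2)} (hi : headTailSeq r i = Letter.Z)
    (hj : headTailSeq r j = Letter.Y) : i < j := by
  unfold headTailSeq at hi hj
  rw [Fin.lt_def]
  split_ifs at hi hj <;> omega

/-- `e` lies below its intersection with `f`. -/
def Low (ord : ℕ → ℕ) (e f : Finset ℕ) : Prop :=
  ∀ z ∈ e, z ∈ f → ∀ u ∈ e, u ∉ f → ord u < ord z

/-- `e` lies above its intersection with `f`. -/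
def Up (ord : ℕ → ℕ) (e f : Finset ℕ) : Prop :=
  ∀ z ∈ e, z ∈ f → ∀ u ∈ e, u ∉ f → ord z < ord u

lemma low_up_aux {r : ℕ} {ord : ℕ → ℕ} {e f : Finset ℕ} (w : Fin (2 * r - 2) → ℕ)
    (h1 : ∀ i j : Fin (2 * r - 2), i < j → ord (w i) < ord (w j))
    (h2 : ∀ v : ℕ, v ∈ e ∪ f → ∃ i, w i = v)
    (h3 : ∀ i, w i ∈ e ↔ headTailSeq r i ≠ Letter.Y)
    (h4 : ∀ i, w i ∈ f ↔ headTailSeq r i ≠ Letter.X) : Low ord e f ∧ Up ord f e := by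
  constructor
  · intro z hz hz' u hu hu'
    obtain ⟨i, rfl⟩ := h2 z (mem_union_left _ hz)
    obtain ⟨j, rfl⟩ := h2 u (mem_union_left _ hu)
    rw [h3] at hz hu
    rw [h4] at hz' hu'
    refine h1 j i (seq_lt (not_not.mp hu') ?_)
    cases h : headTailSeq r i <;> simp_all
  · intro z hz hz' u hu hu'
    obtain ⟨i, rfl⟩ := h2 z (mem_union_left _ hz')
    obtain ⟨j, rfl⟩ := h2 u (mem_union_right _ hu)
    rw [h4] at hz hu
    rw [h3] at hz' hu'
    refine h1 i j (seq_lt' ?_ (not_not.mp hu'))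
    cases h : headTailSeq r i <;> simp_all

lemma low_up {r : ℕ} {ord : ℕ → ℕ} {e f : Finset ℕ} (h : Describes r (headTailSeq r) ord e f) :
    (Low ord e f ∧ Up ord f e) ∨ (Up ord e f ∧ Low ord f e) := by
  obtain ⟨w, h1, h2, h | h⟩ := h
  · exact Or.inl (low_up_aux w h1 (fun v hv => (h2 v).mp hv) h.1 h.2)
  · exact Or.inr (low_up_aux w h1 (fun v hv => (h2 v).mp (by rwa [union_comm])) h.2 h.1).symm

lemma exists_embed (V : Finset ℕ) (ord : ℕ → ℕ) {M : ℕ} (K : Finset (Fin M)) (hK : V.card ≤ K.card)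
    (hK0 : K.Nonempty) :
    ∃ ψ : ℕ → Fin M, (∀ v ∈ V, ψ v ∈ K) ∧ ∀ u ∈ V, ∀ v ∈ V, ord u < ord v → ψ u < ψ v := by
  classical
  obtain ⟨k0, hk0⟩ := hK0
  let rk : ℕ → ℕ := fun v => (V.filter (fun w => ord w < ord v)).card
  have hlt : ∀ u ∈ V, ∀ v, ord u < ord v → rk u < rk v := by
    intro u hu v huv
    refine card_lt_card ?_
    rw [ssubset_iff_of_subset]
    · exact ⟨u, mem_filter.mpr ⟨hu, huv⟩, by simp⟩
    · intro w hw
      obtain ⟨a, b⟩ := mem_filter.mp hw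
      exact mem_filter.mpr ⟨a, b.trans huv⟩
  have hr : ∀ v ∈ V, rk v < K.card := by
    intro v hv
    refine lt_of_lt_of_le (card_lt_card ?_) hK
    rw [ssubset_iff_of_subset (filter_subset _ _)]
    exact ⟨v, hv, by simp⟩
  refine ⟨fun v => if h : rk v < K.card then K.orderEmbOfFin rfl ⟨rk v, h⟩ else k0, ?_, ?_⟩
  · intro v hv
    simp only [hr v hv, dif_pos]
    exact orderEmbOfFin_mem K rfl _
  · intro u hu v hv huv
    simp only [hr v hv, hr u hu, dif_pos]
    exact (K.orderEmbOfFin rfl).strictMono (by simpa [Fin.lt_def] using hlt u hu v huv)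

lemma exists_structure {r : ℕ} (hr : 3 ≤ r) (F : RGraph r) (hql : QuasiLinear F)
    (hadm : AdmitsSeq F (headTailSeq r)) {M : ℕ} (K : Finset (Fin M)) (hK : F.verts.card ≤ K.card)
    (hK0 : K.Nonempty) :
    ∃ (ψ : ℕ → Fin M) (tw : Finset ℕ → Finset ℕ) (lo : Finset ℕ → Prop),
      Set.InjOn ψ ↑F.verts ∧ (∀ v ∈ F.verts, ψ v ∈ K) ∧
      ∀ e ∈ F.edges, tw e ∈ F.edges ∧ tw e ≠ e ∧ tw (tw e) = e ∧
        (∀ f ∈ F.edges, f ≠ e → f ≠ tw e → (e ∩ f).card ≤ 1) ∧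
        (lo (tw e) ↔ ¬ lo e) ∧
        (lo e → tl (e.image ψ) = (e ∩ tw e).image ψ) ∧
        (¬ lo e → hd (e.image ψ) = (e ∩ tw e).image ψ) := by
  classical
  obtain ⟨ord, hord, hdesc⟩ := hadm
  obtain ⟨ψ, hψK, hψ⟩ := exists_embed F.verts ord K hK hK0
  have hinj : Set.InjOn ψ ↑F.verts := by
    intro u hu v hv huv
    rcases lt_trichotomy (ord u) (ord v) with h | h | h
    · exact absurd huv (hψ u hu v hv h).ne
    · exact hord hu hv h
    · exact absurd huv (hψ v hv u hu h).ne'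
  choose! tw htw1 htw2 htw3 htw4 using hql
  have htt : ∀ e ∈ F.edges, tw (tw e) = e := by
    intro e he
    by_contra hne
    have := htw4 (tw e) (htw1 e he) e he (htw2 e he).symm (Ne.symm hne)
    rw [inter_comm, htw3 e he] at this
    omega
  have hLU : ∀ e ∈ F.edges, (Low ord e (tw e) ∧ Up ord (tw e) e) ∨
      (Up ord e (tw e) ∧ Low ord (tw e) e) := fun e he =>
    low_up (hdesc e (tw e) ⟨he, htw1 e he, (htw2 e he).symm, htw3 e he⟩)
  have hex : ∀ e ∈ F.edges, Up ord e (tw e) → ¬ Low ord e (tw e) := by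
    intro e he hu hl
    have c := htw3 e he
    obtain ⟨z, hz⟩ := card_pos.mp (show 0 < (e ∩ tw e).card by omega)
    have : (e ∩ tw e).card < e.card := by rw [c, F.edges_card e he]; omega
    obtain ⟨u, hu1, hu2⟩ := exists_mem_notMem_of_card_lt_card this
    have hz := mem_inter.mp hz
    have hu2 : u ∉ tw e := fun h => hu2 (mem_inter.mpr ⟨hu1, h⟩)
    exact absurd (hu z hz.1 hz.2 u hu1 hu2) (hl z hz.1 hz.2 u hu1 hu2).asymm
  have hZc : ∀ e ∈ F.edges, ((e ∩ tw e).image ψ).card = 2 := by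
    intro e he
    rw [card_image_of_injOn, htw3 e he]
    exact hinj.mono fun x hx => F.edges_subset e he (mem_inter.mp hx).1
  have hw : ∀ e ∈ F.edges, ∀ w ∈ e.image ψ, w ∉ (e ∩ tw e).image ψ → ∃ u ∈ e, u ∉ tw e ∧ ψ u = w := by
    intro e he w hw hn
    obtain ⟨u, hu, rfl⟩ := mem_image.mp hw
    exact ⟨u, hu, fun h => hn (mem_image_of_mem ψ (mem_inter.mpr ⟨hu, h⟩)), rfl⟩
  refine ⟨ψ, tw, fun e => Low ord e (tw e), hinj, hψK, fun e he => ⟨htw1 e he, htw2 e he, htt e he,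
    htw4 e he, ?_, ?_, ?_⟩⟩
  · beta_reduce
    rw [htt e he]
    have h1 := hex e he
    have h2 := hex (tw e) (htw1 e he)
    rw [htt e he] at h2
    rcases hLU e he with ⟨a, b⟩ | ⟨a, b⟩
    · exact ⟨fun h => absurd h (h2 b), fun h => absurd a h⟩
    · exact ⟨fun _ => h1 a, fun _ => b⟩
  · intro hl
    refine tl_eq (image_subset_image inter_subset_left) (hZc e he) ?_
    intro z hz w hw1 hw2
    obtain ⟨u, hu, hu', rfl⟩ := hw e he w hw1 hw2
    obtain ⟨z, hz0, rfl⟩ := mem_image.mp hz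
    obtain ⟨hz, hz'⟩ := mem_inter.mp hz0
    exact hψ u (F.edges_subset e he hu) z (F.edges_subset e he hz) (hl z hz hz' u hu hu')
  · intro hl
    have hup : Up ord e (tw e) := by
      rcases hLU e he with ⟨a, b⟩ | ⟨a, b⟩
      · exact absurd a hl
      · exact a
    refine hd_eq (image_subset_image inter_subset_left) (hZc e he) ?_
    intro z hz w hw1 hw2
    obtain ⟨u, hu, hu', rfl⟩ := hw e he w hw1 hw2
    obtain ⟨z, hz0, rfl⟩ := mem_image.mp hz
    obtain ⟨hz, hz'⟩ := mem_inter.mp hz0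
    exact hψ z (F.edges_subset e he hz) u (F.edges_subset e he hu) (hup z hz hz' u hu hu')

end UTD

namespace UTD
open Finset

/-- All the regularity information about a box used in the embedding argument. -/
structure RegData {M : ℕ} (T : Fin M → Finset ℕ) (HI : Finset (Fin M) → (Fin M → ℕ) → Prop)
    (δ η : ℝ) where
  Wh : Finset (Fin M) → (Fin M → ℕ) → ℝ
  Wt : Finset (Fin M) → (Fin M → ℕ) → ℝ
  a : Finset (Fin M) → ℝ
  g : Finset (Fin M) → Finset (Fin M) → ℝ
  hWh0 : ∀ I x, 0 ≤ Wh I x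
  hWt0 : ∀ I x, 0 ≤ Wt I x
  hWhD : ∀ I, Dep (Wh I) (hd I)
  hWtD : ∀ I, Dep (Wt I) (tl I)
  hWh : ∀ I, Reg T (ind (HI I)) (Wh I) (I \ hd I) η
  hWt : ∀ I, Reg T (ind (HI I)) (Wt I) (I \ tl I) η
  ha : ∀ I, Reg T (ind (fun x => δ ≤ Wh I x)) (fun _ => a I) (hd I) η
  hg0 : ∀ I I', 0 ≤ g I I'
  hg : ∀ I I', tl I = hd I' →
    Reg T (ind (fun x => δ ≤ Wt I x ∧ δ ≤ Wh I' x)) (fun _ => g I I') (tl I) η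

lemma approx_const {ι : Type} [Fintype ι] [DecidableEq ι] {T : ι → Finset ℕ}
    {P : (ι → ℕ) → Prop} {W : (ι → ℕ) → ℝ} {L : Finset ι} {η : ℝ}
    (hA : Approx (ind P) W L) (hR : Reg T (ind P) W L η) (hP : Dep P L) :
    Reg T (ind P) (fun _ => W (fun _ => 0)) L η := by
  have : W = fun _ => W (fun _ => 0) := by
    funext x
    refine hA.2.2 L hP.ind x _ fun i hi => ?_
    simp at hi
  rw [← this]; exact hR

lemma exists_regData (M : ℕ) (δ η : ℝ) (hη : 0 < η) :
    ∃ c : ℝ, 0 < c ∧ c ≤ 1 ∧ ∀ HI : Finset (Fin M) → (Fin M → ℕ) → Prop, (∀ I, Dep (HI I) I) →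
      ∀ T : Fin M → Finset ℕ, (∀ i, (T i).Nonempty) →
      ∃ T' : Fin M → Finset ℕ, (∀ i, T' i ⊆ T i) ∧ (∀ i, (T' i).Nonempty) ∧
        (∀ i, c * (T i).card ≤ ((T' i).card : ℝ)) ∧ Nonempty (RegData T' HI δ η) := by
  obtain ⟨c2, hc2, hc2', h2⟩ := exists_reg_family (Fin M)
    (Finset (Fin M) ⊕ (Finset (Fin M) × Finset (Fin M))) η hη
  obtain ⟨c1, hc1, hc1', h1⟩ := exists_reg_family (Fin M)
    (Finset (Fin M) ⊕ Finset (Fin M)) (η * c2 ^ Fintype.card (Fin M)) (by positivity)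
  refine ⟨c1 * c2, by positivity, mul_le_one₀ hc1' hc2.le hc2', fun HI hHI T hT => ?_⟩
  obtain ⟨T1, hs1, hn1, hcd1, hW1⟩ := h1
    (fun q => Sum.elim (fun I => ind (HI I)) (fun I => ind (HI I)) q)
    (fun q => Sum.elim (fun I => I \ hd I) (fun I => I \ tl I) q)
    (by rintro (I | I) x <;> exact ⟨ind_nonneg _ _, ind_le _ _⟩) T hT
  have hh := fun I => hW1 (Sum.inl I)
  have ht := fun I => hW1 (Sum.inr I)
  simp only [Sum.elim_inl, Sum.elim_inr] at hh ht
  choose Wh hWhA hWhR using hh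
  choose Wt hWtA hWtR using ht
  have hWhD : ∀ I, Dep (Wh I) (hd I) := by
    intro I
    have := (hWhA I).2.2 I (hHI I).ind
    rwa [Finset.sdiff_sdiff_eq_self (hd_subset I)] at this
  have hWtD : ∀ I, Dep (Wt I) (tl I) := by
    intro I
    have := (hWtA I).2.2 I (hHI I).ind
    rwa [Finset.sdiff_sdiff_eq_self (tl_subset I)] at this
  obtain ⟨T2, hs2, hn2, hcd2, hW2⟩ := h2
    (fun q => Sum.elim (fun I => ind (fun x => δ ≤ Wh I x))
      (fun p => ind (fun x => δ ≤ Wt p.1 x ∧ δ ≤ Wh p.2 x)) q)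
    (fun q => Sum.elim (fun I => hd I) (fun p => tl p.1) q)
    (by rintro (I | I) x <;> simp only [Sum.elim_inl, Sum.elim_inr] <;>
      exact ⟨ind_nonneg _ _, ind_le _ _⟩) T1 hn1
  have hha := fun I => hW2 (Sum.inl I)
  have hhg := fun I I' => hW2 (Sum.inr (I, I'))
  simp only [Sum.elim_inl, Sum.elim_inr] at hha hhg
  choose Ua hUaA hUaR using hha
  choose Ug hUgA hUgR using hhg
  refine ⟨T2, fun i => (hs2 i).trans (hs1 i), hn2, fun i => ?_, ⟨{
    Wh := Wh
    Wt := Wt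
    a := fun I => Ua I (fun _ => 0)
    g := fun I I' => Ug I I' (fun _ => 0)
    hWh0 := fun I => (hWhA I).1
    hWt0 := fun I => (hWtA I).1
    hWhD := hWhD
    hWtD := hWtD
    hWh := fun I => (hWhR I).mono hc2 hη.le hs2 hcd2
    hWt := fun I => (hWtR I).mono hc2 hη.le hs2 hcd2
    ha := fun I => approx_const (hUaA I) (hUaR I) ?_
    hg0 := fun I I' => (hUgA I I').1 _
    hg := fun I I' hII => approx_const (hUgA I I') (hUgR I I') ?_ }⟩⟩
  · calc c1 * c2 * ((T i).card : ℝ) = c2 * (c1 * (T i).card) := by ring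
      _ ≤ c2 * (T1 i).card := mul_le_mul_of_nonneg_left (hcd1 i) hc2.le
      _ ≤ _ := hcd2 i
  · intro x y hxy
    show (δ ≤ Wh I x) = (δ ≤ Wh I y)
    rw [hWhD I x y hxy]
  · intro x y hxy
    show (δ ≤ Wt I x ∧ δ ≤ Wh I' x) = (δ ≤ Wt I y ∧ δ ≤ Wh I' y)
    rw [hWtD I x y hxy, hWhD I' x y (by rw [← hII]; exact hxy)]

section cntK
variable {ι : Type} [Fintype ι] [DecidableEq ι]

lemma cnt_mono {T : ι → Finset ℕ} {P Q : (ι → ℕ) → Prop} (h : ∀ x, P x → Q x) :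
    cnt T P ≤ cnt T Q := by
  rw [cnt_eq, cnt_eq]
  refine sum_le_sum fun x _ => ?_
  by_cases hp : P x
  · simp [ind, hp, h x hp]
  · simp only [ind, hp, if_false]; split_ifs <;> norm_num

lemma cnt_le_vol (T : ι → Finset ℕ) (P : (ι → ℕ) → Prop) : cnt T P ≤ vol T := by
  classical
  unfold cnt vol
  exact_mod_cast card_filter_le _ _

lemma cnt_nonneg (T : ι → Finset ℕ) (P : (ι → ℕ) → Prop) : 0 ≤ cnt T P := by
  unfold cnt; positivity

lemma cnt_true (T : ι → Finset ℕ) (P : (ι → ℕ) → Prop) (h : ∀ x, P x) : cnt T P = vol T := by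
  classical
  unfold cnt vol
  rw [filter_true_of_mem fun x _ => h x]

lemma cnt_and (T : ι → Finset ℕ) (P Q : (ι → ℕ) → Prop) :
    cnt T P + cnt T Q - vol T ≤ cnt T (fun x => P x ∧ Q x) := by
  rw [cnt_eq, cnt_eq, cnt_eq]
  have : vol T = ∑ x ∈ Fintype.piFinset T, (1 : ℝ) := by simp [vol]
  rw [this, ← sum_add_distrib, ← sum_sub_distrib]
  refine sum_le_sum fun x _ => ?_
  by_cases hp : P x <;> by_cases hq : Q x <;> simp [ind, hp, hq]

lemma reg_one {T : ι → Finset ℕ} (hT : ∀ i, (T i).Nonempty) {f W : (ι → ℕ) → ℝ} {L I : Finset ι}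
    {η : ℝ} (h : Reg T f W L η) (hLI : L ⊆ I) (hf : Dep f I) (hW : Dep W I)
    (φ : (ι → ℕ) → Prop) (D : Finset ι) (hφ : Dep φ D)
    (hD : Disjoint D L ∨ (D ∩ I).card ≤ 1) :
    |∑ x ∈ Fintype.piFinset T, ind φ x * (f x - W x)| ≤ η * vol T := by
  classical
  have := h.strong hT hLI hf hW (κ := Unit) (fun _ => φ) (fun _ => D) (fun _ => hφ) (fun _ => hD)
  rw [sum_filter] at this
  convert this using 3 with x _
  by_cases hp : φ x <;> simp [ind, hp]

end cntK

section L1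
variable {M : ℕ} {T : Fin M → Finset ℕ} {HI : Finset (Fin M) → (Fin M → ℕ) → Prop} {δ η : ℝ}

lemma cnt_const {T : Fin M → Finset ℕ} (hT : ∀ i, (T i).Nonempty) {P : (Fin M → ℕ) → Prop} {a : ℝ}
    {L : Finset (Fin M)} (h : Reg T (ind P) (fun _ => a) L η) (hP : Dep P L) :
    |cnt T P - a * vol T| ≤ η * vol T := by
  have := reg_one hT h subset_rfl hP.ind (fun _ _ _ => rfl) (fun _ => True) ∅
    (fun _ _ _ => rfl) (Or.inl (disjoint_empty_left _))
  have e : ∑ x ∈ Fintype.piFinset T, ind (fun _ => True) x * (ind P x - a) =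
      cnt T P - a * vol T := by
    rw [cnt_eq]
    have e1 : ∀ x : Fin M → ℕ, ind (fun _ => True) x = 1 := fun x => by simp [ind]
    simp only [e1, one_mul, sum_sub_distrib]
    simp [vol, mul_comm]
  rwa [e] at this

lemma mass_out (hT : ∀ i, (T i).Nonempty) {P : (Fin M → ℕ) → Prop} {W : (Fin M → ℕ) → ℝ}
    {I A : Finset (Fin M)} (hA : A ⊆ I) (h : Reg T (ind P) W (I \ A) η) (hP : Dep P I)
    (hW : Dep W A) :
    cnt T (fun x => P x ∧ ¬ δ ≤ W x) ≤ (max δ 0 + η) * vol T := by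
  have h1 := (abs_le.mp (reg_one hT h sdiff_subset hP.ind (hW.mono hA) (fun x => ¬ δ ≤ W x) A
    (fun x y hxy => by simp only [hW x y hxy]) (Or.inl disjoint_sdiff))).2
  have h2 : cnt T (fun x => P x ∧ ¬ δ ≤ W x) ≤
      ∑ x ∈ Fintype.piFinset T, (ind (fun x => ¬ δ ≤ W x) x * (ind P x - W x) + max δ 0) := by
    rw [cnt_eq]
    refine sum_le_sum fun x _ => ?_
    have := le_max_left δ 0
    have := le_max_right δ 0
    by_cases hp : P x <;> by_cases hq : δ ≤ W x <;> simp [ind, hp, hq] <;> push Not at hq <;> 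
      first | done | linarith | skip
    all_goals first | exact Or.inl (hq.le) | linarith
  rw [sum_add_distrib] at h2
  have h3 : ∑ x ∈ Fintype.piFinset T, max δ 0 = max δ 0 * vol T := by simp [vol, mul_comm]
  rw [h3] at h2
  linarith

lemma product_bound (hT : ∀ i, (T i).Nonempty) (R : RegData T HI δ η) (hHI : ∀ I, Dep (HI I) I)
    (hδ : 0 ≤ δ) (hη : 0 ≤ η) {I : Finset (Fin M)} (hI : 3 ≤ I.card) :
    cnt T (HI I) * vol T ≤ cnt T (fun x => δ ≤ R.Wh I x) * cnt T (fun x => δ ≤ R.Wt I x) +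
      (2 * δ + 4 * η) * vol T * vol T := by
  have hv := vol_pos hT
  have h1 := mass_out (δ := δ) hT (hd_subset I) (R.hWh I) (hHI I) (R.hWhD I)
  have h2 := mass_out (δ := δ) hT (tl_subset I) (R.hWt I) (hHI I) (R.hWtD I)
  rw [max_eq_left hδ] at h1 h2
  have hDh : Dep (fun x => δ ≤ R.Wh I x) (hd I) := fun x y hxy => by simp only [R.hWhD I x y hxy]
  have hDt : Dep (fun x => δ ≤ R.Wt I x) (tl I) := fun x y hxy => by simp only [R.hWtD I x y hxy]
  have h3 := (abs_le.mp (cnt_const hT (R.ha I) hDh)).1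
  have h4 := (abs_le.mp (reg_one hT (R.ha I) subset_rfl hDh.ind (fun _ _ _ => rfl) _ _ hDt
    (Or.inr (by rw [inter_comm]; exact hd_inter_tl hI)))).2
  have h5 : ∑ x ∈ Fintype.piFinset T, ind (fun x => δ ≤ R.Wt I x) x *
      (ind (fun x => δ ≤ R.Wh I x) x - R.a I) =
      cnt T (fun x => δ ≤ R.Wh I x ∧ δ ≤ R.Wt I x) - R.a I * cnt T (fun x => δ ≤ R.Wt I x) := by
    rw [cnt_eq, cnt_eq, mul_sum, ← sum_sub_distrib]
    refine sum_congr rfl fun x _ => ?_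
    by_cases hp : δ ≤ R.Wh I x <;> by_cases hq : δ ≤ R.Wt I x <;> simp [ind, hp, hq]
  rw [h5] at h4
  have h6 : cnt T (HI I) ≤ cnt T (fun x => δ ≤ R.Wh I x ∧ δ ≤ R.Wt I x) +
      cnt T (fun x => HI I x ∧ ¬ δ ≤ R.Wh I x) + cnt T (fun x => HI I x ∧ ¬ δ ≤ R.Wt I x) := by
    simp only [cnt_eq]
    rw [← sum_add_distrib, ← sum_add_distrib]
    refine sum_le_sum fun x _ => ?_
    by_cases hp : δ ≤ R.Wh I x <;> by_cases hq : δ ≤ R.Wt I x <;> by_cases hh : HI I x <;>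
      simp [ind, hp, hq, hh]
  have ht := cnt_nonneg T (fun x => δ ≤ R.Wt I x)
  have ht' := cnt_le_vol T (fun x => δ ≤ R.Wt I x)
  generalize cnt T (fun x => δ ≤ R.Wt I x) = t at *
  generalize cnt T (fun x => δ ≤ R.Wh I x) = h at *
  generalize vol T = v at *
  have h7 : cnt T (HI I) ≤ R.a I * t + η * v + 2 * ((δ + η) * v) := by linarith
  have h8 : R.a I * v ≤ h + η * v := by linarith
  calc cnt T (HI I) * v ≤ (R.a I * t + η * v + 2 * ((δ + η) * v)) * v :=
        mul_le_mul_of_nonneg_right h7 hv.le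
    _ = (R.a I * v) * t + (2 * δ + 3 * η) * v * v := by ring
    _ ≤ (h + η * v) * t + (2 * δ + 3 * η) * v * v := by
        have := mul_le_mul_of_nonneg_right h8 ht; linarith
    _ ≤ _ := by
        have := mul_le_mul_of_nonneg_left ht' (mul_nonneg hη hv.le); nlinarith

end L1
end UTD

namespace UTD
open Finset

lemma count_edges {r : ℕ} (F : RGraph r) {M : ℕ} {T : Fin M → Finset ℕ}
    {HI : Finset (Fin M) → (Fin M → ℕ) → Prop} {δ η γ : ℝ} (hT : ∀ i, (T i).Nonempty)
    (R : RegData T HI δ η) (hHI : ∀ I, Dep (HI I) I) (hη : 0 ≤ η) (hδ : 0 ≤ δ) (hδ1 : δ ≤ 1)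
    (hγ : 0 ≤ γ) (hγ1 : γ ≤ 1)
    (ψ : ℕ → Fin M) (tw : Finset ℕ → Finset ℕ) (lo : Finset ℕ → Prop)
    (hinj : Set.InjOn ψ ↑F.verts)
    (hs : ∀ e ∈ F.edges, tw e ∈ F.edges ∧ tw e ≠ e ∧ tw (tw e) = e ∧
        (∀ f ∈ F.edges, f ≠ e → f ≠ tw e → (e ∩ f).card ≤ 1) ∧
        (lo (tw e) ↔ ¬ lo e) ∧
        (lo e → tl (e.image ψ) = (e ∩ tw e).image ψ) ∧
        (¬ lo e → hd (e.image ψ) = (e ∩ tw e).image ψ))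
    (hg : ∀ e ∈ F.edges, lo e → γ ≤ R.g (e.image ψ) ((tw e).image ψ)) :
    (δ ^ F.edges.card * γ ^ F.edges.card - 2 * F.edges.card * η) * vol T ≤
      cnt T (fun x => ∀ e ∈ F.edges, HI (e.image ψ) x) := by
  classical
  have hv := vol_nonneg T
  have hinterc : ∀ e ∈ F.edges, ∀ f ∈ F.edges, e ≠ f → e ≠ tw f →
      (e.image ψ ∩ f.image ψ).card ≤ 1 := by
    intro e he f hf h1 h2
    have : (e ∩ f).image ψ = e.image ψ ∩ f.image ψ := by
      rw [image_inter_of_injOn]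
      refine hinj.mono ?_
      rintro x (hx | hx)
      · exact F.edges_subset e he hx
      · exact F.edges_subset f hf hx
    rw [← this, inter_comm]
    exact card_image_le.trans ((hs f hf).2.2.2.1 e he h1 h2)
  have hDh : ∀ I, Dep (fun x => δ ≤ R.Wh I x) (hd I) := fun I x y hxy => by
    simp only [R.hWhD I x y hxy]
  have hDt : ∀ I, Dep (fun x => δ ≤ R.Wt I x) (tl I) := fun I x y hxy => by
    simp only [R.hWtD I x y hxy]
  have c1 := chain hT F.edges (fun e => HI (e.image ψ))
    (fun e x => if lo e then δ ≤ R.Wt (e.image ψ) x else δ ≤ R.Wh (e.image ψ) x)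
    (fun e => if lo e then R.Wt (e.image ψ) else R.Wh (e.image ψ))
    (fun e => e.image ψ \ (if lo e then tl (e.image ψ) else hd (e.image ψ)))
    (fun e => e.image ψ) hη hδ hδ1
    (by
      intro e he
      by_cases h : lo e
      · simpa [h] using R.hWt (e.image ψ)
      · simpa [h] using R.hWh (e.image ψ))
    (fun e he => sdiff_subset) (fun e he => hHI _)
    (by
      intro e he
      by_cases h : lo e
      · simpa [h] using (hDt (e.image ψ)).mono (tl_subset _)
      · simpa [h] using (hDh (e.image ψ)).mono (hd_subset _))
    (by
      intro e he
      by_cases h : lo e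
      · simpa [h] using (R.hWtD (e.image ψ)).mono (tl_subset _)
      · simpa [h] using (R.hWhD (e.image ψ)).mono (hd_subset _))
    (by
      intro e he x
      by_cases h : lo e
      · simpa [h] using R.hWt0 (e.image ψ) x
      · simpa [h] using R.hWh0 (e.image ψ) x)
    (by
      intro e he x
      by_cases h : lo e <;> simp [h])
    (by
      intro e he f hf hef
      by_cases htw : e = tw f
      · left
        have hZ : (if lo f then tl (f.image ψ) else hd (f.image ψ)) = (f ∩ tw f).image ψ := by
          by_cases h : lo f
          · simpa [h] using (hs f hf).2.2.2.2.2.1 h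
          · simpa [h] using (hs f hf).2.2.2.2.2.2 h
        simp only [hZ]
        rw [disjoint_left]
        intro y hy hy'
        obtain ⟨u, hu, rfl⟩ := mem_image.mp hy
        obtain ⟨hy1, hy2⟩ := mem_sdiff.mp hy'
        obtain ⟨v, hv, huv⟩ := mem_image.mp hy1
        have := hinj (F.edges_subset f hf hv) (F.edges_subset e he hu) huv
        subst this
        exact hy2 (mem_image_of_mem ψ (mem_inter.mpr ⟨hv, htw ▸ hu⟩))
      · exact Or.inr (hinterc e he f hf hef htw))
  have hth : ∀ e ∈ F.edges, lo e → tl (e.image ψ) = hd ((tw e).image ψ) := by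
    intro e he h
    obtain ⟨h1, h2, h3, h4, h5, h6, h7⟩ := hs e he
    have := (hs _ h1).2.2.2.2.2.2 (by rw [h5]; simpa using h)
    rw [h6 h, this, h3, inter_comm]
  have c2 := chain hT (F.edges.filter lo)
    (fun e x => δ ≤ R.Wt (e.image ψ) x ∧ δ ≤ R.Wh ((tw e).image ψ) x)
    (fun _ _ => True) (fun e _ => R.g (e.image ψ) ((tw e).image ψ))
    (fun e => tl (e.image ψ)) (fun e => tl (e.image ψ)) hη hγ hγ1
    (fun e he => R.hg _ _ (hth e (mem_filter.mp he).1 (mem_filter.mp he).2))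
    (fun e he => subset_rfl)
    (by
      intro e he x y hxy
      have := hth e (mem_filter.mp he).1 (mem_filter.mp he).2
      simp only [R.hWtD _ x y hxy, R.hWhD _ x y (by rw [← this]; exact hxy)])
    (fun _ _ _ _ _ => rfl) (fun _ _ _ _ _ => rfl) (fun e he _ => R.hg0 _ _)
    (fun e he _ _ => hg e (mem_filter.mp he).1 (mem_filter.mp he).2)
    (by
      intro e he f hf hef
      right
      obtain ⟨he, hle⟩ := mem_filter.mp he
      obtain ⟨hf, hlf⟩ := mem_filter.mp hf
      refine le_trans (card_le_card (inter_subset_inter (tl_subset _) (tl_subset _)))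
        (hinterc e he f hf hef ?_)
      rintro rfl
      exact (hs f hf).2.2.2.2.1.mp hle hlf)
  rw [cnt_true T _ (by simp)] at c2
  have c3 : cnt T (fun x => ∀ e ∈ F.edges.filter lo,
        δ ≤ R.Wt (e.image ψ) x ∧ δ ≤ R.Wh ((tw e).image ψ) x) ≤
      cnt T (fun x => ∀ e ∈ F.edges,
        if lo e then δ ≤ R.Wt (e.image ψ) x else δ ≤ R.Wh (e.image ψ) x) := by
    refine cnt_mono fun x hx e he => ?_
    by_cases h : lo e
    · simpa [h] using (hx e (mem_filter.mpr ⟨he, h⟩)).1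
    · obtain ⟨h1, h2, h3, h4, h5, h6, h7⟩ := hs e he
      have := (hx (tw e) (mem_filter.mpr ⟨h1, h5.mpr h⟩)).2
      rw [h3] at this
      simpa [h] using this
  have hJ : (F.edges.filter lo).card ≤ F.edges.card := card_filter_le _ _
  have hJ' : ((F.edges.filter lo).card : ℝ) ≤ F.edges.card := by exact_mod_cast hJ
  have c4 : γ ^ F.edges.card ≤ γ ^ (F.edges.filter lo).card := pow_le_pow_of_le_one hγ hγ1 hJ
  have c5 : (γ ^ F.edges.card - F.edges.card * η) * vol T ≤ cnt T (fun x => ∀ e ∈ F.edges,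
        if lo e then δ ≤ R.Wt (e.image ψ) x else δ ≤ R.Wh (e.image ψ) x) := by
    have a1 := mul_le_mul_of_nonneg_right c4 hv
    have a2 := mul_le_mul_of_nonneg_right hJ' (mul_nonneg hη hv)
    linarith
  have hp0 : 0 ≤ δ ^ F.edges.card := by positivity
  have hp1 : δ ^ F.edges.card ≤ 1 := pow_le_one₀ hδ hδ1
  have c6 := mul_le_mul_of_nonneg_left c5 hp0
  have c7 : δ ^ F.edges.card * (F.edges.card * η * vol T) ≤ 1 * (F.edges.card * η * vol T) :=
    mul_le_mul_of_nonneg_right hp1 (by positivity)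
  refine le_trans ?_ c1
  linarith

lemma exists_parts (V : Finset ℕ) (M : ℕ) (hM : 0 < M) : ∃ S : Fin M → Finset ℕ, (∀ i, S i ⊆ V) ∧
    (∀ i j, i ≠ j → Disjoint (S i) (S j)) ∧ ∀ i, (S i).card = V.card / M := by
  classical
  set q := V.card / M
  have hq : M * q ≤ V.card := Nat.mul_div_le _ _
  let E := V.orderEmbOfFin rfl
  have hb : ∀ (i : Fin M) (j : Fin q), (i : ℕ) * q + j < V.card := by
    intro i j
    have h1 := j.2
    have h2 : ((i : ℕ) + 1) * q ≤ M * q := Nat.mul_le_mul_right _ i.2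
    have : ((i : ℕ) + 1) * q = i * q + q := by ring
    omega
  have hinj : ∀ (i i' : Fin M) (j j' : Fin q), E ⟨i * q + j, hb i j⟩ = E ⟨i' * q + j', hb i' j'⟩ →
      i = i' ∧ j = j' := by
    intro i i' j j' h
    have h := Fin.mk.inj_iff.mp (E.injective h)
    have hqp : 0 < q := lt_of_le_of_lt (Nat.zero_le _) j.2
    have h1 : (i * q + j : ℕ) / q = i := by
      rw [mul_comm, Nat.mul_add_div hqp, Nat.div_eq_of_lt j.2, add_zero]
    have h2 : (i' * q + j' : ℕ) / q = i' := by
      rw [mul_comm, Nat.mul_add_div hqp, Nat.div_eq_of_lt j'.2, add_zero]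
    have h3 : (i : ℕ) = i' := by rw [← h1, h, h2]
    refine ⟨Fin.ext h3, Fin.ext ?_⟩
    rw [h3] at h; omega
  refine ⟨fun i => (univ : Finset (Fin q)).image (fun j : Fin q => (E ⟨(i : ℕ) * q + (j : ℕ), hb i j⟩ : ℕ)), ?_, ?_, ?_⟩
  · intro i y hy
    obtain ⟨j, _, rfl⟩ := mem_image.mp hy
    exact orderEmbOfFin_mem V rfl _
  · intro i i' hii
    rw [disjoint_left]
    intro y hy hy'
    obtain ⟨j, _, rfl⟩ := mem_image.mp hy
    obtain ⟨j', _, h⟩ := mem_image.mp hy'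
    exact hii (hinj _ _ _ _ h).1.symm
  · intro i
    rw [card_image_of_injective]
    · simp
    · intro j j' h
      exact (hinj _ _ _ _ h).2

end UTD

namespace UTD
open Finset

lemma floor_close {a b κ : ℝ} (hκ : 0 < κ)
    (h : ⌊a * κ⌋₊ = ⌊b * κ⌋₊) : a * κ ≤ b * κ + 1 ∨ b < 0 := by
  by_cases hb : b < 0
  · exact Or.inr hb
  left
  push Not at hb
  have h1 := Nat.lt_floor_add_one (a * κ)
  have h2 := Nat.floor_le (mul_nonneg hb hκ.le)
  rw [h] at h1
  linarith

lemma exists_of_cnt_pos {ι : Type} [Fintype ι] [DecidableEq ι] {T : ι → Finset ℕ}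
    {P : (ι → ℕ) → Prop} (h : 0 < cnt T P) : ∃ x ∈ Fintype.piFinset T, P x := by
  rw [cnt_eq] at h
  obtain ⟨x, hx, hne⟩ := exists_ne_zero_of_sum_ne_zero h.ne'
  refine ⟨x, hx, ?_⟩
  by_contra hP
  exact hne (by simp [ind, hP])

lemma core {r : ℕ} (hr : 3 ≤ r) (F : RGraph r) (hql : QuasiLinear F)
    (hadm : AdmitsSeq F (headTailSeq r)) {ε : ℝ} (hε : 0 < ε) (hε1 : ε ≤ 1) :
    ∃ ε₀ : ℝ, 0 < ε₀ ∧ ∃ N₀ : ℕ, ∀ (H : RGraph r) (ε' : ℝ), ε' ≤ ε₀ → N₀ ≤ H.verts.card →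
      IsDense H (1 / 4 + ε) ε' → IsSubgraph F H := by
  classical
  set δ := ε / 32 with hδ
  set γ := ε / 16 with hγ
  have hδ0 : 0 < δ := by positivity
  have hγ0 : 0 < γ := by positivity
  set n := F.edges.card with hn
  set η := min (ε / 64) ((δ ^ n * γ ^ n) / (2 * n + 1)) with hη
  have hη0 : 0 < η := lt_min (by positivity) (by positivity)
  have hη1 : η ≤ ε / 64 := min_le_left _ _
  have hη2 : 2 * n * η < δ ^ n * γ ^ n := by
    have h1 : η ≤ (δ ^ n * γ ^ n) / (2 * n + 1) := min_le_right _ _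
    rw [le_div_iff₀ (by positivity)] at h1
    linarith
  set m := max (max F.verts.card r) ⌈(r : ℝ) ^ 2 * 4 / ε⌉₊ + 1 with hm
  have hmF : F.verts.card ≤ m := by omega
  have hmr : r ≤ m := by omega
  have hm0 : 0 < m := by omega
  have hmε : (r : ℝ) ^ 2 ≤ (ε / 4) * m := by
    have h1 : (r : ℝ) ^ 2 * 4 / ε ≤ m := by
      refine (Nat.le_ceil _).trans ?_
      have h2 : ⌈(r : ℝ) ^ 2 * 4 / ε⌉₊ ≤ m := by omega
      exact Nat.cast_le.mpr h2
    rw [div_le_iff₀ hε] at h1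
    linarith
  set κ := 16 / ε with hκ
  have hκ0 : 0 < κ := by positivity
  obtain ⟨M₀, hM₀⟩ := ramsey_aux (C := Fin (⌊κ⌋₊ + 1) × Fin (⌊κ⌋₊ + 1)) r m
  set M := M₀ + 1 with hM
  obtain ⟨c, hc0, hc1, hreg⟩ := exists_regData M δ η hη0
  refine ⟨min (ε / 8) (c / (2 * M)), lt_min (by positivity) (by positivity), M, ?_⟩
  intro H ε' hε' hV hdense
  obtain ⟨S, hSV, hSd, hSc⟩ := exists_parts H.verts M (by omega)
  set q := H.verts.card / M with hq
  have hq1 : 1 ≤ q := (Nat.one_le_div_iff (by omega)).mpr hV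
  have hHI : ∀ I : Finset (Fin M), Dep (fun x => I.image x ∈ H.edges) I := by
    intro I x y hxy
    have : I.image x = I.image y := image_congr fun i hi => hxy i hi
    simp only [this]
  obtain ⟨T, hTS, hTn, hTc, ⟨R⟩⟩ := hreg (fun I x => I.image x ∈ H.edges) hHI S
    (fun i => card_pos.mp (by rw [hSc]; omega))
  have hTd : ∀ i j, i ≠ j → Disjoint (T i) (T j) := fun i j hij =>
    disjoint_of_subset_left (hTS i) (disjoint_of_subset_right (hTS j) (hSd i j hij))
  have hTV : ∀ i, T i ⊆ H.verts := fun i => (hTS i).trans (hSV i)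
  set s := ⌈c * (q : ℝ)⌉₊ with hs
  have hq1' : (1 : ℝ) ≤ q := by exact_mod_cast hq1
  have hs1 : 1 ≤ s := Nat.ceil_pos.mpr (by positivity)
  have hsT : ∀ i, s ≤ (T i).card := fun i => Nat.ceil_le.mpr (by rw [← hSc i]; exact hTc i)
  have hlarge : ε' * H.verts.card ≤ (m * s : ℕ) := by
    have h1 : ε' ≤ c / (2 * M) := hε'.trans (min_le_right _ _)
    have h2 : (H.verts.card : ℝ) ≤ 2 * M * q := by
      have : H.verts.card < M * (q + 1) := by
        have := Nat.lt_mul_div_succ H.verts.card (show 0 < M by omega)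
        simpa [hq] using this
      have h3 : H.verts.card ≤ 2 * M * q := by nlinarith
      exact_mod_cast h3
    have hMp : (0 : ℝ) < 2 * M := by rw [hM]; positivity
    calc ε' * H.verts.card ≤ c / (2 * M) * H.verts.card := by gcongr
      _ ≤ c / (2 * M) * (2 * M * q) := by gcongr
      _ = c * q := by rw [div_mul_eq_mul_div, div_eq_iff hMp.ne']; ring
      _ ≤ s := Nat.le_ceil _
      _ ≤ (m * s : ℕ) := by exact_mod_cast Nat.le_mul_of_pos_left s hm0
  have hv := vol_pos hTn
  -- normalised densities
  set h : Finset (Fin M) → ℝ := fun I => cnt T (fun x => δ ≤ R.Wh I x) / vol T with hh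
  set t : Finset (Fin M) → ℝ := fun I => cnt T (fun x => δ ≤ R.Wt I x) / vol T with ht
  have hh0 : ∀ I, 0 ≤ h I := fun I => div_nonneg (cnt_nonneg _ _) hv.le
  have ht0 : ∀ I, 0 ≤ t I := fun I => div_nonneg (cnt_nonneg _ _) hv.le
  have hh1 : ∀ I, h I ≤ 1 := fun I => div_le_one_of_le₀ (cnt_le_vol _ _) hv.le
  have ht1 : ∀ I, t I ≤ 1 := fun I => div_le_one_of_le₀ (cnt_le_vol _ _) hv.le
  have hfl : ∀ a : ℝ, a ≤ 1 → ⌊a * κ⌋₊ < ⌊κ⌋₊ + 1 := fun a ha =>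
    Nat.lt_succ_of_le (Nat.floor_mono (by nlinarith))
  obtain ⟨K, -, hKm, col, hcol⟩ := hM₀ (Fin M) univ (by simp [hM])
    (fun I => (⟨⌊h I * κ⌋₊, hfl _ (hh1 I)⟩, ⟨⌊t I * κ⌋₊, hfl _ (ht1 I)⟩))
  obtain ⟨I₀, hI₀K, hI₀r, hI₀⟩ := density_lemma H hTd hTV K hKm hm0 hmr hε hε1 hmε hs1 hsT hdense
    (hε'.trans (min_le_left _ _)) hlarge
  have hclose : ∀ I ⊆ K, I.card = r → h I₀ ≤ h I + ε / 16 ∧ t I₀ ≤ t I + ε / 16 := by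
    intro I hIK hIr
    have e := (hcol I₀ hI₀K hI₀r).trans (hcol I hIK hIr).symm
    have e1 : ⌊h I₀ * κ⌋₊ = ⌊h I * κ⌋₊ := congrArg (fun p => (p.1 : ℕ)) e
    have e2 : ⌊t I₀ * κ⌋₊ = ⌊t I * κ⌋₊ := congrArg (fun p => (p.2 : ℕ)) e
    have hκε : κ * (ε / 16) = 1 := by rw [hκ]; field_simp
    constructor
    · rcases floor_close hκ0 e1 with h1 | h1
      · refine le_of_mul_le_mul_right ?_ hκ0
        linarith
      · exact absurd (hh0 I) (not_le.mpr h1)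
    · rcases floor_close hκ0 e2 with h1 | h1
      · refine le_of_mul_le_mul_right ?_ hκ0
        linarith
      · exact absurd (ht0 I) (not_le.mpr h1)
  have hprod : 1 / 4 + 3 * ε / 8 ≤ h I₀ * t I₀ := by
    have p := product_bound hTn R hHI hδ0.le hη0.le (I := I₀) (by omega)
    have p1 := mul_le_mul_of_nonneg_right hI₀ hv.le
    have e1 : cnt T (fun x => δ ≤ R.Wh I₀ x) = h I₀ * vol T := by
      rw [hh]; field_simp
    have e2 : cnt T (fun x => δ ≤ R.Wt I₀ x) = t I₀ * vol T := by
      rw [ht]; field_simp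
    rw [e1, e2] at p
    have p2 := p1.trans p
    have p3 : (1 / 4 + ε / 2) * (vol T * vol T) ≤
        (h I₀ * t I₀ + (2 * δ + 4 * η)) * (vol T * vol T) := by linarith
    have p4 := le_of_mul_le_mul_right p3 (mul_pos hv hv)
    linarith
  have hsum : 1 + ε / 4 ≤ h I₀ + t I₀ := by
    by_contra hcon
    push Not at hcon
    nlinarith [sq_nonneg (h I₀ - t I₀), hh0 I₀, ht0 I₀]
  obtain ⟨ψ, tw, lo, hinj, hψK, hst⟩ := exists_structure hr F hql hadm K (by omega)
    (card_pos.mp (by omega))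
  have hIm : ∀ e ∈ F.edges, e.image ψ ⊆ K ∧ (e.image ψ).card = r := by
    intro e he
    refine ⟨fun y hy => ?_, ?_⟩
    · obtain ⟨v, hv, rfl⟩ := mem_image.mp hy
      exact hψK v (F.edges_subset e he hv)
    · rw [card_image_of_injOn (hinj.mono (F.edges_subset e he)), F.edges_card e he]
  have hgγ : ∀ e ∈ F.edges, lo e → γ ≤ R.g (e.image ψ) ((tw e).image ψ) := by
    intro e he hlo
    obtain ⟨h1, h2, h3, h4, h5, h6, h7⟩ := hst e he
    have hth : tl (e.image ψ) = hd ((tw e).image ψ) := by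
      have := (hst _ h1).2.2.2.2.2.2 (by rw [h5]; simpa using hlo)
      rw [h6 hlo, this, h3, inter_comm]
    have q1 := (hclose _ (hIm e he).1 (hIm e he).2).2
    have q2 := (hclose _ (hIm _ h1).1 (hIm _ h1).2).1
    have q3 := cnt_and T (fun x => δ ≤ R.Wt (e.image ψ) x) (fun x => δ ≤ R.Wh ((tw e).image ψ) x)
    have e1 : cnt T (fun x => δ ≤ R.Wh ((tw e).image ψ) x) = h ((tw e).image ψ) * vol T := by
      rw [hh]; field_simp
    have e2 : cnt T (fun x => δ ≤ R.Wt (e.image ψ) x) = t (e.image ψ) * vol T := by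
      rw [ht]; field_simp
    rw [e1, e2] at q3
    have q4 := (abs_le.mp (cnt_const hTn (R.hg _ _ hth) (by
      intro x y hxy
      simp only [R.hWtD _ x y hxy, R.hWhD _ x y (by rw [← hth]; exact hxy)]))).2
    have q5 : (t (e.image ψ) + h ((tw e).image ψ) - 1) * vol T ≤
        (R.g (e.image ψ) ((tw e).image ψ) + η) * vol T := by linarith
    have q6 := le_of_mul_le_mul_right q5 hv
    linarith
  have hcount := count_edges F hTn R hHI hη0.le hδ0.le (by linarith) hγ0.le (by linarith)
    ψ tw lo hinj hst hgγ
  have hpos : 0 < cnt T (fun x => ∀ e ∈ F.edges, (e.image ψ).image x ∈ H.edges) :=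
    lt_of_lt_of_le (mul_pos (by linarith) hv) hcount
  obtain ⟨x, hxT, hxE⟩ := exists_of_cnt_pos hpos
  rw [Fintype.mem_piFinset] at hxT
  refine ⟨fun v => x (ψ v), ?_, fun v _ => hTV _ (hxT _), fun e he => ?_⟩
  · intro u hu v hv huv
    refine hinj hu hv ?_
    by_contra hne
    refine disjoint_left.mp (hTd _ _ hne) (hxT _) ?_
    simp only at huv
    rw [huv]; exact hxT _
  · have := hxE e he
    rwa [image_image] at this

theorem density_one_quarter' (r : ℕ) (hr : 3 ≤ r) (F : RGraph r)
    (hql : QuasiLinear F) (hhtm : HeadTailMixing F)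
    (hadm : AdmitsSeq F (headTailSeq r)) :
    ∀ ε : ℝ, 0 < ε → ∀ H : ℕ → RGraph r, LocallyDense H (1 / 4 + ε) →
      ∃ n, IsSubgraph F (H n) := by
  intro ε hε H hH
  obtain ⟨u, hu0, hu, hV, hd⟩ := hH
  obtain ⟨ε₀, hε₀, N₀, hN⟩ := core hr F hql hadm (ε := min ε 1) (lt_min hε one_pos) (min_le_right _ _)
  obtain ⟨n, hn1, hn2⟩ := ((hu.eventually (eventually_le_nhds hε₀)).and
    (hV.eventually (Filter.eventually_ge_atTop N₀))).exists
  refine ⟨n, hN (H n) (u n) hn1 hn2 fun S hS hc => le_trans ?_ (hd n S hS hc)⟩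
  have := min_le_left ε 1
  gcongr

end UTD

namespace UTD

/-- density statement for 1/4. -/
theorem density_one_quarter (r : ℕ) (hr : 3 ≤ r) (F : RGraph r)
    (hql : QuasiLinear F) (hhtm : HeadTailMixing F)
    (hadm : AdmitsSeq F (headTailSeq r)) :
    ∀ ε : ℝ, 0 < ε → ∀ H : ℕ → RGraph r, LocallyDense H (1 / 4 + ε) →
      ∃ n, IsSubgraph F (H n) := by
  exact density_one_quarter' r hr F hql hhtm hadm

end UTD
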